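/- Let n ≥ 2, q > 0 and p ∈ ℝ with p + q > 1, and suppose the Liouville property holds for (p,q) in dimension n. Set a = (p+q−1)/q. Then there exists a constant C = C(n,p,q) > 0 such that for every domain Ω ⊊ ℝ^n with nonempty boundary and every positive classical solution u of Δu + |∇u|^q u^p = 0 on Ω, one has |∇(u^a)(x)| ≤ C · dist(x, ∂Ω)^{−1 − a(2−q)/(p+q−1)} for every x ∈ Ω. Moreover, if in addition p > 1 then the same estimate holds with a = 1. -/

import Mathlib

open scoped BigOperators

/-- The Euclidean Laplacian of `u : ℝⁿ → ℝ`, defined as the sum of the second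
partial derivatives in the coordinate directions. -/
noncomputable def elaplacian {n : ℕ} (u : EuclideanSpace ℝ (Fin n) → ℝ)
    (x : EuclideanSpace ℝ (Fin n)) : ℝ :=
  ∑ i : Fin n, fderiv ℝ (fun y => fderiv ℝ u y (EuclideanSpace.single i 1)) x
    (EuclideanSpace.single i 1)

section

open MeasureTheory Set Filter Topology

section Kernel

variable {E : Type*} [NormedAddCommGroup E]

lemma hasDerivAt_posPart_pow (k : ℕ) (s : ℝ) :
    HasDerivAt (fun s : ℝ => (max s 0) ^ (k + 2)) ((k + 2) * (max s 0) ^ (k + 1)) s := by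
  rcases lt_trichotomy s 0 with hs | rfl | hs
  · rw [max_eq_right hs.le]
    have : (fun s : ℝ => (max s 0) ^ (k + 2)) =ᶠ[𝓝 s] fun _ => 0 := by
      filter_upwards [Iio_mem_nhds hs] with t ht
      rw [max_eq_right (le_of_lt ht)]; simp
    simpa using (hasDerivAt_const s (0 : ℝ)).congr_of_eventuallyEq this
  · have h : HasDerivAt (fun s : ℝ => (max s 0) ^ (k + 2)) 0 0 := by
      rw [hasDerivAt_iff_isLittleO]
      simp only [max_self, sub_zero, smul_zero, ne_eq, Nat.add_eq_zero_iff, OfNat.ofNat_ne_zero,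
        and_false, not_false_eq_true, zero_pow]
      refine (Asymptotics.IsBigO.of_bound 1 (Eventually.of_forall fun x => ?_)).trans_isLittleO
        (Asymptotics.isLittleO_pow_id (n := k + 2) (by omega))
      simp only [norm_pow, one_mul]
      gcongr
      rw [Real.norm_of_nonneg (le_max_right _ _)]
      exact max_le (le_abs_self x) (norm_nonneg x)
    simpa using h
  · rw [max_eq_left hs.le]
    have : (fun s : ℝ => (max s 0) ^ (k + 2)) =ᶠ[𝓝 s] fun s => s ^ (k + 2) := by
      filter_upwards [Ioi_mem_nhds hs] with t ht
      rw [max_eq_left (le_of_lt ht)]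
    refine HasDerivAt.congr_of_eventuallyEq ?_ this
    simpa using hasDerivAt_pow (k + 2) s

lemma contDiff_posPart_pow (m k : ℕ) (h : m < k) :
    ContDiff ℝ m (fun s : ℝ => (max s 0) ^ k) := by
  induction m generalizing k with
  | zero =>
    exact contDiff_zero.2 (by fun_prop)
  | succ m ih =>
    obtain ⟨k, rfl⟩ : ∃ j, k = j + 2 := ⟨k - 2, by omega⟩
    push_cast
    refine contDiff_succ_iff_deriv.2 ⟨fun s => (hasDerivAt_posPart_pow k s).differentiableAt,
      fun h => by simp at h, ?_⟩
    rw [funext fun s => (hasDerivAt_posPart_pow k s).deriv]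
    exact contDiff_const.mul (ih (k + 1) (by omega))

/-- The radial kernel `(1 - ‖y‖²)₊ ^ k`. -/
noncomputable def ballKernel (k : ℕ) (y : E) : ℝ := (max (1 - ‖y‖ ^ 2) 0) ^ k

lemma ballKernel_nonneg (k : ℕ) (y : E) : 0 ≤ ballKernel k y := pow_nonneg (le_max_right _ _) _

lemma ballKernel_le_one (k : ℕ) (y : E) : ballKernel k y ≤ 1 :=
  pow_le_one₀ (le_max_right _ _) (max_le (by nlinarith [norm_nonneg y]) zero_le_one)

lemma ballKernel_succ_le (k : ℕ) (y : E) : ballKernel (k + 1) y ≤ ballKernel k y := by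
  unfold ballKernel
  exact pow_le_pow_of_le_one (le_max_right _ _)
    (max_le (by nlinarith [norm_nonneg y]) zero_le_one) (by omega)

lemma ballKernel_eq_zero {k : ℕ} (hk : k ≠ 0) {y : E} (hy : 1 ≤ ‖y‖) : ballKernel k y = 0 := by
  unfold ballKernel
  rw [max_eq_right (by nlinarith), zero_pow hk]

lemma ballKernel_ge {k : ℕ} {y : E} (hy : ‖y‖ ≤ 1 / 2) : (3 / 4 : ℝ) ^ k ≤ ballKernel k y := by
  unfold ballKernel
  gcongr
  exact le_max_of_le_left (by nlinarith [norm_nonneg y])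

/-- The primitive `Φ` of the averaging kernel: `∇Φ(y) = - (1 - ‖y‖²)₊³ y`. -/
noncomputable def potKernel (y : E) : ℝ := ballKernel 4 y / 8

lemma potKernel_nonneg (y : E) : 0 ≤ potKernel y :=
  div_nonneg (ballKernel_nonneg _ _) (by norm_num)

lemma potKernel_le (y : E) : potKernel y ≤ ballKernel 3 y := by
  have := ballKernel_succ_le 3 y
  have := ballKernel_nonneg 3 y
  unfold potKernel
  linarith

lemma potKernel_eq_zero {y : E} (hy : 1 ≤ ‖y‖) : potKernel y = 0 := by
  simp [potKernel, ballKernel_eq_zero (show (4 : ℕ) ≠ 0 by norm_num) hy]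

variable [InnerProductSpace ℝ E]

lemma contDiff_ballKernel (m k : ℕ) (h : m < k) : ContDiff ℝ m (ballKernel k : E → ℝ) :=
  (contDiff_posPart_pow m k h).comp (contDiff_const.sub (contDiff_norm_sq ℝ))

lemma hasFDerivAt_ballKernel (k : ℕ) (y : E) :
    HasFDerivAt (ballKernel (k + 2) : E → ℝ)
      (-(2 * (k + 2) * ballKernel (k + 1) y) • innerSL ℝ y) y := by
  have h1 : HasFDerivAt (fun y : E => 1 - ‖y‖ ^ 2) (-(2 • innerSL ℝ y)) y :=
    ((hasStrictFDerivAt_norm_sq y).hasFDerivAt).const_sub 1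
  have := (hasDerivAt_posPart_pow k (1 - ‖y‖ ^ 2)).comp_hasFDerivAt y h1
  refine this.congr_fderiv ?_
  ext v
  simp [ballKernel]
  ring

/-- The directional derivative of `potKernel` in direction `b`. -/
noncomputable def potKernelDir (b y : E) : ℝ := -(ballKernel 3 y * inner ℝ y b)

lemma fderiv_potKernel (y b : E) : fderiv ℝ (potKernel : E → ℝ) y b = potKernelDir b y := by
  have h := ((hasFDerivAt_ballKernel 2 y).mul_const (1 / 8 : ℝ))
  have h' : HasFDerivAt (potKernel : E → ℝ) _ y := h.congr_of_eventuallyEq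
    (Eventually.of_forall fun y => by simp [potKernel, div_eq_mul_inv])
  rw [h'.fderiv]
  simp [potKernelDir]
  ring

lemma contDiff_potKernel : ContDiff ℝ 2 (potKernel : E → ℝ) :=
  (contDiff_ballKernel 2 4 (by norm_num)).div_const 8

lemma contDiff_potKernelDir (b : E) : ContDiff ℝ 2 (potKernelDir b) :=
  ((contDiff_ballKernel 2 3 (by norm_num)).mul (contDiff_id.inner ℝ contDiff_const)).neg

lemma potKernelDir_eq_zero (b : E) {y : E} (hy : 1 ≤ ‖y‖) : potKernelDir b y = 0 := by
  simp [potKernelDir, ballKernel_eq_zero (show (3 : ℕ) ≠ 0 by norm_num) hy]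

lemma abs_potKernelDir_le (b y : E) : |potKernelDir b y| ≤ ‖b‖ * ballKernel 3 y := by
  rcases le_or_gt 1 ‖y‖ with hy | hy
  · rw [potKernelDir_eq_zero b hy, ballKernel_eq_zero (by norm_num) hy]; simp
  · rw [potKernelDir, abs_neg, abs_mul, abs_of_nonneg (ballKernel_nonneg _ _), mul_comm]
    refine mul_le_mul_of_nonneg_right ((abs_real_inner_le_norm y b).trans ?_)
      (ballKernel_nonneg _ _)
    nlinarith [norm_nonneg b]

lemma fderiv_ballKernel_three (y a : E) :
    fderiv ℝ (ballKernel 3 : E → ℝ) y a = -(6 * ballKernel 2 y * inner ℝ y a) := by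
  rw [(hasFDerivAt_ballKernel 1 y).fderiv]
  simp
  norm_num

lemma abs_fderiv_ballKernel_three_le (y a : E) :
    |fderiv ℝ (ballKernel 3 : E → ℝ) y a| ≤ 6 * ‖a‖ := by
  rw [fderiv_ballKernel_three]
  rcases le_or_gt 1 ‖y‖ with hy | hy
  · rw [ballKernel_eq_zero (by norm_num) hy]; simp
  · rw [abs_neg, abs_mul, abs_mul, abs_of_nonneg (ballKernel_nonneg 2 y)]
    have h1 := ballKernel_le_one 2 y
    have h0 := ballKernel_nonneg 2 y
    have h2 := (abs_real_inner_le_norm y a).trans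
      (mul_le_mul_of_nonneg_right hy.le (norm_nonneg a))
    have h3 := abs_nonneg (inner ℝ y a)
    rw [abs_of_pos (by norm_num : (0 : ℝ) < 6)]
    nlinarith [mul_nonneg h0 h3, mul_nonneg (sub_nonneg.2 h1) h3]

lemma fderiv_ballKernel_three_eq_zero (a : E) {y : E} (hy : 1 ≤ ‖y‖) :
    fderiv ℝ (ballKernel 3 : E → ℝ) y a = 0 := by
  rw [fderiv_ballKernel_three, ballKernel_eq_zero (by norm_num) hy]; simp

lemma abs_fderiv_ballKernel_three_le_dilate (y a : E) :
    |fderiv ℝ (ballKernel 3 : E → ℝ) y a| ≤ 15 * ‖a‖ * ballKernel 3 ((1 / 2 : ℝ) • y) := by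
  rcases le_or_gt 1 ‖y‖ with hy | hy
  · rw [fderiv_ballKernel_three_eq_zero a hy, abs_zero]
    have := ballKernel_nonneg 3 ((1 / 2 : ℝ) • y)
    positivity
  · refine (abs_fderiv_ballKernel_three_le y a).trans ?_
    have h : (3 / 4 : ℝ) ^ 3 ≤ ballKernel 3 ((1 / 2 : ℝ) • y) := by
      apply ballKernel_ge
      rw [norm_smul, Real.norm_of_nonneg (by norm_num)]
      linarith
    nlinarith [norm_nonneg a, mul_le_mul_of_nonneg_left h (norm_nonneg a)]

lemma fderiv_potKernelDir (a y b : E) :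
    fderiv ℝ (potKernelDir a) y b =
      6 * ballKernel 2 y * inner ℝ y b * inner ℝ y a - ballKernel 3 y * inner ℝ b a := by
  have h1 := hasFDerivAt_ballKernel 1 y
  have h2 : HasFDerivAt (fun y : E => inner ℝ y a) _ y :=
    (hasFDerivAt_id y).inner ℝ (hasFDerivAt_const a y)
  have h : HasFDerivAt (potKernelDir a) _ y := (h1.mul h2).neg
  rw [h.fderiv]
  simp
  ring

lemma fderiv_potKernelDir_eq_zero (a b : E) {y : E} (hy : 1 ≤ ‖y‖) :
    fderiv ℝ (potKernelDir a) y b = 0 := by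
  rw [fderiv_potKernelDir, ballKernel_eq_zero (by norm_num) hy,
    ballKernel_eq_zero (by norm_num) hy]; simp

lemma abs_fderiv_potKernelDir_le (a y b : E) :
    |fderiv ℝ (potKernelDir a) y b| ≤ 7 * ‖a‖ * ‖b‖ := by
  rcases le_or_gt 1 ‖y‖ with hy | hy
  · rw [fderiv_potKernelDir_eq_zero a b hy, abs_zero]; positivity
  · rw [fderiv_potKernelDir]
    have ha := (abs_real_inner_le_norm y a).trans
      (mul_le_mul_of_nonneg_right hy.le (norm_nonneg a))
    have hb := (abs_real_inner_le_norm y b).trans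
      (mul_le_mul_of_nonneg_right hy.le (norm_nonneg b))
    have hab := abs_real_inner_le_norm b a
    rw [one_mul] at ha hb
    have h2 := ballKernel_le_one 2 y
    have h2' := ballKernel_nonneg 2 y
    have h3 := ballKernel_le_one 3 y
    have h3' := ballKernel_nonneg 3 y
    calc _ ≤ |6 * ballKernel 2 y * inner ℝ y b * inner ℝ y a| + |ballKernel 3 y * inner ℝ b a| :=
          abs_sub _ _
      _ = 6 * ballKernel 2 y * |inner ℝ y b| * |inner ℝ y a| +
            ballKernel 3 y * |inner ℝ b a| := by
          simp only [abs_mul, abs_of_nonneg h2', abs_of_nonneg h3']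
          norm_num
      _ ≤ 6 * 1 * ‖b‖ * ‖a‖ + 1 * (‖b‖ * ‖a‖) := by gcongr
      _ = _ := by ring

end Kernel

/-- Euclidean space of dimension `n`. -/
abbrev Euc (n : ℕ) := EuclideanSpace ℝ (Fin n)

/-- A continuous kernel vanishing outside the open unit ball. -/
structure IsBallKernel {n : ℕ} (ψ : Euc n → ℝ) : Prop where
  continuous : Continuous ψ
  eq_zero : ∀ y, 1 ≤ ‖y‖ → ψ y = 0

section Average

variable {n : ℕ} {F G ψ χ : Euc n → ℝ}

lemma IsBallKernel.hasCompactSupport (h : IsBallKernel ψ) : HasCompactSupport ψ := by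
  refine HasCompactSupport.intro (isCompact_closedBall 0 1) fun y hy => h.eq_zero y ?_
  simp only [Metric.mem_closedBall, dist_zero_right, not_le] at hy
  exact hy.le

lemma IsBallKernel.integrable_mul (h : IsBallKernel ψ) (hF : Continuous F) :
    Integrable (fun y => F y * ψ y) :=
  (hF.mul h.continuous).integrable_of_hasCompactSupport h.hasCompactSupport.mul_left

lemma IsBallKernel.integrable (h : IsBallKernel ψ) : Integrable ψ :=
  h.continuous.integrable_of_hasCompactSupport h.hasCompactSupport

lemma integral_kernel_mono (hF : Continuous F) (hψ : IsBallKernel ψ) (hG : Continuous G)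
    (hχ : IsBallKernel χ) (h : ∀ y, ‖y‖ < 1 → F y * ψ y ≤ G y * χ y) :
    ∫ y, F y * ψ y ≤ ∫ y, G y * χ y := by
  refine integral_mono (hψ.integrable_mul hF) (hχ.integrable_mul hG) fun y => ?_
  rcases lt_or_ge ‖y‖ 1 with hy | hy
  · exact h y hy
  · simp [hψ.eq_zero y hy, hχ.eq_zero y hy]

lemma abs_integral_kernel_le (hψ : IsBallKernel ψ) (hG : Continuous G)
    (hχ : IsBallKernel χ) (h : ∀ y, ‖y‖ < 1 → |F y * ψ y| ≤ G y * χ y) :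
    |∫ y, F y * ψ y| ≤ ∫ y, G y * χ y := by
  rw [← Real.norm_eq_abs]
  refine norm_integral_le_of_norm_le (hχ.integrable_mul hG) (Eventually.of_forall fun y => ?_)
  rcases lt_or_ge ‖y‖ 1 with hy | hy
  · exact h y hy
  · simp [hψ.eq_zero y hy, hχ.eq_zero y hy]

lemma abs_integral_kernel_le_volume {M : ℝ} (hψ : IsBallKernel ψ)
    (h : ∀ y, ‖y‖ < 1 → |F y * ψ y| ≤ M) :
    |∫ y, F y * ψ y| ≤ M * volume.real (Metric.ball (0 : Euc n) 1) := by
  rw [← Real.norm_eq_abs, ← setIntegral_eq_integral_of_forall_compl_eq_zero (s := Metric.ball (0 : Euc n) 1)]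
  · refine norm_setIntegral_le_of_norm_le_const measure_ball_lt_top fun y hy => h y ?_
    simpa using hy
  · intro y hy
    rw [hψ.eq_zero y (by simpa using hy), mul_zero]

lemma hasDerivAt_average (hF : ContDiff ℝ 1 F) (hψ : IsBallKernel ψ) (x : Euc n) (t : ℝ) :
    HasDerivAt (fun t : ℝ => ∫ y, F (x - t • y) * ψ y)
      (∫ y, -(fderiv ℝ F (x - t • y) y) * ψ y) t := by
  have hdF : Continuous (fderiv ℝ F) := hF.continuous_fderiv one_ne_zero
  obtain ⟨C, hC⟩ : ∃ C, ∀ z ∈ Metric.closedBall x (|t| + 1), ‖fderiv ℝ F z‖ ≤ C :=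
    (isCompact_closedBall x (|t| + 1)).exists_bound_of_continuousOn hdF.continuousOn
  have hψ' : IsBallKernel fun y => |ψ y| :=
    ⟨hψ.continuous.abs, fun y hy => by simp [hψ.eq_zero y hy]⟩
  refine (hasDerivAt_integral_of_dominated_loc_of_deriv_le (μ := volume)
    (F := fun (t : ℝ) (y : Euc n) => F (x - t • y) * ψ y)
    (F' := fun (t : ℝ) (y : Euc n) => -(fderiv ℝ F (x - t • y) y) * ψ y)
    (bound := fun y => C * |ψ y|) (Metric.ball_mem_nhds t one_pos) ?_ ?_ ?_ ?_ ?_ ?_).2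
  · refine Eventually.of_forall fun s => ((hF.continuous.comp ?_).mul
      hψ.continuous).aestronglyMeasurable
    fun_prop
  · exact hψ.integrable_mul (hF.continuous.comp (by fun_prop))
  · refine (Continuous.mul ?_ hψ.continuous).aestronglyMeasurable
    exact ((hdF.comp (by fun_prop)).clm_apply continuous_id).neg
  · refine Eventually.of_forall fun y s hs => ?_
    rcases lt_or_ge ‖y‖ 1 with hy | hy
    · rw [norm_mul, Real.norm_eq_abs (ψ y), norm_neg]
      refine mul_le_mul_of_nonneg_right ?_ (abs_nonneg _)
      have hz : x - s • y ∈ Metric.closedBall x (|t| + 1) := by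
        rw [Metric.mem_closedBall, dist_eq_norm, sub_sub_cancel_left, norm_neg, norm_smul]
        have : |s| ≤ |t| + 1 := by
          have := abs_sub_abs_le_abs_sub s t
          rw [Metric.mem_ball, Real.dist_eq] at hs
          linarith
        rw [Real.norm_eq_abs]
        nlinarith [norm_nonneg y, abs_nonneg s]
      have h1 := hC _ hz
      have h2 := (fderiv ℝ F (x - s • y)).le_opNorm y
      nlinarith [norm_nonneg y, norm_nonneg (fderiv ℝ F (x - s • y))]
    · simp [hψ.eq_zero y hy]
  · exact hψ'.integrable_mul continuous_const
  · refine Eventually.of_forall fun y s _ => ?_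
    have h1 : HasDerivAt (fun s : ℝ => x - s • y) (-y) s := by
      simpa using ((hasDerivAt_id s).smul_const y).const_sub x
    have h2 := ((hF.differentiable one_ne_zero (x - s • y)).hasFDerivAt.comp_hasDerivAt s h1)
    have h3 := h2.mul_const (ψ y)
    rw [map_neg] at h3
    exact h3

lemma continuous_average (hF : ContDiff ℝ 1 F) (hψ : IsBallKernel ψ) (x : Euc n) :
    Continuous (fun t : ℝ => ∫ y, F (x - t • y) * ψ y) :=
  continuous_iff_continuousAt.2 fun t => (hasDerivAt_average hF hψ x t).continuousAt

lemma isBallKernel_fderiv (hψ : ContDiff ℝ 1 ψ) (hs : IsBallKernel ψ) (b : Euc n) :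
    IsBallKernel fun y => fderiv ℝ ψ y b := by
  have hc : Continuous fun y => fderiv ℝ ψ y b :=
    (hψ.continuous_fderiv one_ne_zero).clm_apply continuous_const
  have h0 : ∀ y, 1 < ‖y‖ → fderiv ℝ ψ y b = 0 := fun y hy => by
    have : ψ =ᶠ[𝓝 y] fun _ => 0 := by
      filter_upwards [(isOpen_lt continuous_const continuous_norm).mem_nhds hy] with z hz
      exact hs.eq_zero z (le_of_lt hz)
    rw [this.fderiv_eq]; simp
  refine ⟨hc, fun y hy => ?_⟩
  have hy0 : y ≠ 0 := by rintro rfl; simp at hy; linarith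
  have hlim : Tendsto (fun k : ℝ => fderiv ℝ ψ (k • y) b) (𝓝[>] 1) (𝓝 (fderiv ℝ ψ y b)) := by
    have : Continuous fun k : ℝ => fderiv ℝ ψ (k • y) b := hc.comp (by fun_prop)
    simpa using (this.tendsto 1).mono_left nhdsWithin_le_nhds
  refine tendsto_nhds_unique hlim (tendsto_const_nhds.congr' ?_)
  filter_upwards [self_mem_nhdsWithin] with k hk
  rw [h0]
  rw [norm_smul, Real.norm_of_nonneg (by linarith [mem_Ioi.1 hk])]
  nlinarith [mem_Ioi.1 hk]

/-- Integration by parts in a rescaled average. -/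
lemma average_fderiv_kernel (hF : ContDiff ℝ 1 F) (hψ : ContDiff ℝ 1 ψ) (hs : IsBallKernel ψ)
    (x b : Euc n) (t : ℝ) :
    ∫ y, F (x - t • y) * fderiv ℝ ψ y b = t * ∫ y, fderiv ℝ F (x - t • y) b * ψ y := by
  have hG : ∀ y, HasFDerivAt (fun y => F (x - t • y)) (-(t • fderiv ℝ F (x - t • y))) y :=
    fun y => by
      have h1 : HasFDerivAt (fun y : Euc n => x - t • y)
          (-(t • ContinuousLinearMap.id ℝ (Euc n))) y :=
        ((hasFDerivAt_id y).const_smul t).const_sub x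
      have h2 := (hF.differentiable one_ne_zero (x - t • y)).hasFDerivAt.comp y h1
      refine h2.congr_fderiv ?_
      ext v; simp
  have hcF : Continuous fun y => F (x - t • y) := hF.continuous.comp (by fun_prop)
  have hcD : Continuous fun y => fderiv ℝ F (x - t • y) b :=
    ((hF.continuous_fderiv one_ne_zero).comp (by fun_prop)).clm_apply continuous_const
  have hfd : ∀ y, fderiv ℝ (fun y => F (x - t • y)) y b = -t * fderiv ℝ F (x - t • y) b := by
    intro y; rw [(hG y).fderiv]; simp
  rw [integral_mul_fderiv_eq_neg_fderiv_mul_of_integrable]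
  · rw [← integral_neg, ← integral_const_mul]
    refine integral_congr_ae (Eventually.of_forall fun y => ?_)
    simp only [hfd]; ring
  · simp only [hfd]
    exact hs.integrable_mul (continuous_const.mul hcD)
  · exact (isBallKernel_fderiv hψ hs b).integrable_mul hcF
  · exact hs.integrable_mul hcF
  · exact fun y _ => (hG y).differentiableAt
  · exact fun y _ => hψ.differentiable one_ne_zero y

lemma integral_fderiv_kernel (hψ : ContDiff ℝ 1 ψ) (hs : IsBallKernel ψ) (b : Euc n) :
    ∫ y, fderiv ℝ ψ y b = 0 := by
  have := average_fderiv_kernel (F := fun _ => 1) contDiff_const hψ hs 0 b 0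
  simpa using this

lemma isBallKernel_ballKernel {k : ℕ} (hk : k ≠ 0) : IsBallKernel (ballKernel k : Euc n → ℝ) :=
  ⟨(contDiff_ballKernel 0 k (by omega)).continuous, fun _ => ballKernel_eq_zero hk⟩

lemma isBallKernel_potKernel : IsBallKernel (potKernel : Euc n → ℝ) :=
  ⟨contDiff_potKernel.continuous, fun _ => potKernel_eq_zero⟩

lemma isBallKernel_potKernelDir (b : Euc n) : IsBallKernel (potKernelDir b) :=
  ⟨(contDiff_potKernelDir b).continuous, fun _ => potKernelDir_eq_zero b⟩

/-- The total mass of the averaging kernel. -/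
noncomputable def kernelMass (n : ℕ) : ℝ := ∫ y : Euc n, ballKernel 3 y

lemma integral_pos_of_pos_zero (hψ : IsBallKernel ψ) (h0 : ∀ y, 0 ≤ ψ y) (h : 0 < ψ 0) :
    0 < ∫ y, ψ y :=
  hψ.continuous.integral_pos_of_hasCompactSupport_nonneg_nonzero hψ.hasCompactSupport h0 h.ne'

lemma kernelMass_pos : 0 < kernelMass n :=
  integral_pos_of_pos_zero (isBallKernel_ballKernel (by norm_num)) (ballKernel_nonneg 3)
    (by simp [ballKernel])

lemma integral_potKernel_pos : 0 < ∫ y : Euc n, potKernel y :=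
  integral_pos_of_pos_zero isBallKernel_potKernel potKernel_nonneg
    (by simp [potKernel, ballKernel])

end Average

section Identities

variable {n : ℕ} {u ψ : Euc n → ℝ}

lemma ContDiff.fderiv_one (hu : ContDiff ℝ 2 u) : ContDiff ℝ 1 (fderiv ℝ u) :=
  hu.fderiv_right (by norm_num)

lemma ContDiff.fderiv_apply_one (hu : ContDiff ℝ 2 u) (b : Euc n) :
    ContDiff ℝ 1 fun y => fderiv ℝ u y b :=
  hu.fderiv_one.clm_apply contDiff_const

lemma fderiv_fderiv_apply (hu : ContDiff ℝ 2 u) (x a b : Euc n) :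
    fderiv ℝ (fun y => fderiv ℝ u y b) x a = fderiv ℝ (fderiv ℝ u) x a b := by
  have h := (hu.fderiv_one.differentiable one_ne_zero x).hasFDerivAt.clm_apply
    (hasFDerivAt_const b x)
  rw [h.fderiv]
  simp

lemma fderiv_fderiv_symm (hu : ContDiff ℝ 2 u) (x a b : Euc n) :
    fderiv ℝ (fderiv ℝ u) x a b = fderiv ℝ (fderiv ℝ u) x b a :=
  (hu.contDiffAt.isSymmSndFDerivAt (by simp)) a b

lemma elaplacian_eq (hu : ContDiff ℝ 2 u) (x : Euc n) :
    elaplacian u x = ∑ i, fderiv ℝ (fderiv ℝ u) x (EuclideanSpace.single i 1)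
      (EuclideanSpace.single i 1) :=
  Finset.sum_congr rfl fun _ _ => fderiv_fderiv_apply hu x _ _

lemma continuous_fderiv_fderiv (hu : ContDiff ℝ 2 u) : Continuous (fderiv ℝ (fderiv ℝ u)) :=
  hu.fderiv_one.continuous_fderiv one_ne_zero

lemma continuous_elaplacian (hu : ContDiff ℝ 2 u) : Continuous (elaplacian u) := by
  rw [funext (elaplacian_eq hu)]
  exact continuous_finsetSum _ fun i _ =>
    ((continuous_fderiv_fderiv hu).clm_apply continuous_const).clm_apply continuous_const

lemma sum_coord_mul (l : Euc n →L[ℝ] ℝ) (y : Euc n) :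
    ∑ i, l (EuclideanSpace.single i 1) * inner ℝ y (EuclideanSpace.single i 1) = l y := by
  have h := (EuclideanSpace.basisFun (Fin n) ℝ).sum_repr y
  conv_rhs => rw [← h]
  rw [map_sum]
  refine Finset.sum_congr rfl fun i _ => ?_
  simp [EuclideanSpace.inner_single_right, mul_comm]

/-- Two integrations by parts move a derivative from the kernel to the function. -/
lemma sum_average_swap (hu : ContDiff ℝ 2 u) (hψ : ContDiff ℝ 2 ψ) (hs : IsBallKernel ψ)
    (x b : Euc n) {t : ℝ} (ht : t ≠ 0) :
    ∑ i, ∫ y, fderiv ℝ (fderiv ℝ u) (x - t • y) (EuclideanSpace.single i 1) b *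
        fderiv ℝ ψ y (EuclideanSpace.single i 1) =
      ∫ y, elaplacian u (x - t • y) * fderiv ℝ ψ y b := by
  have hψ1 : ContDiff ℝ 1 ψ := hψ.of_le (by norm_num)
  have hc : ∀ a b : Euc n, Continuous fun y => fderiv ℝ (fderiv ℝ u) (x - t • y) a b := fun a b =>
    (((continuous_fderiv_fderiv hu).comp (by fun_prop)).clm_apply
      continuous_const).clm_apply continuous_const
  simp_rw [elaplacian_eq hu, Finset.sum_mul]
  rw [integral_finsetSum _ fun i _ => (isBallKernel_fderiv hψ1 hs b).integrable_mul (hc _ _)]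
  refine Finset.sum_congr rfl fun i _ => ?_
  set e := EuclideanSpace.single i (1 : ℝ)
  have h1 := average_fderiv_kernel (hu.fderiv_apply_one e) (hψ.fderiv_apply_one e)
    (isBallKernel_fderiv hψ1 hs e) x b t
  have h2 := average_fderiv_kernel (hu.fderiv_apply_one e) (hψ.fderiv_apply_one b)
    (isBallKernel_fderiv hψ1 hs b) x e t
  simp_rw [fderiv_fderiv_apply hu, fderiv_fderiv_apply hψ] at h1 h2
  simp_rw [fderiv_fderiv_symm hψ _ b e] at h1
  rw [h1] at h2
  have h3 := mul_left_cancel₀ ht h2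
  simp_rw [fderiv_fderiv_symm hu _ b e] at h3
  exact h3

lemma hasDerivAt_average_laplacian (hu : ContDiff ℝ 2 u) (x : Euc n) (t : ℝ) :
    HasDerivAt (fun t : ℝ => ∫ y, u (x - t • y) * ballKernel 3 y)
      (t * ∫ y, elaplacian u (x - t • y) * potKernel y) t := by
  have hk : IsBallKernel (potKernel : Euc n → ℝ) := isBallKernel_potKernel
  have hk1 : ContDiff ℝ 1 (potKernel : Euc n → ℝ) := contDiff_potKernel.of_le (by norm_num)
  have hc : ∀ b : Euc n, Continuous fun y => fderiv ℝ u (x - t • y) b := fun b =>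
    ((hu.fderiv_one.continuous).comp (by fun_prop)).clm_apply continuous_const
  have hc2 : ∀ a b : Euc n, Continuous fun y => fderiv ℝ (fderiv ℝ u) (x - t • y) a b :=
    fun a b => (((continuous_fderiv_fderiv hu).comp (by fun_prop)).clm_apply
      continuous_const).clm_apply continuous_const
  convert hasDerivAt_average (hu.of_le (by norm_num))
    (isBallKernel_ballKernel (k := 3) (by norm_num)) x t using 1
  have h1 : ∀ y, -(fderiv ℝ u (x - t • y) y) * ballKernel 3 y =
      ∑ i, fderiv ℝ u (x - t • y) (EuclideanSpace.single i 1) *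
        fderiv ℝ potKernel y (EuclideanSpace.single i 1) := fun y => by
    rw [← sum_coord_mul (fderiv ℝ u (x - t • y)) y, ← Finset.sum_neg_distrib, Finset.sum_mul]
    refine Finset.sum_congr rfl fun i _ => ?_
    rw [fderiv_potKernel, potKernelDir]; ring
  simp_rw [h1, elaplacian_eq hu, Finset.sum_mul]
  rw [integral_finsetSum _ fun i _ => (isBallKernel_fderiv hk1 hk _).integrable_mul (hc _),
    integral_finsetSum _ fun i _ => hk.integrable_mul (hc2 _ _), Finset.mul_sum]
  refine Finset.sum_congr rfl fun i _ => ?_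
  rw [average_fderiv_kernel (hu.fderiv_apply_one _) hk1 hk]
  simp_rw [fderiv_fderiv_apply hu]

lemma hasDerivAt_average_fderiv (hu : ContDiff ℝ 2 u) (x b : Euc n) {t : ℝ} (ht : t ≠ 0) :
    HasDerivAt (fun t : ℝ => ∫ y, fderiv ℝ u (x - t • y) b * ballKernel 3 y)
      (∫ y, elaplacian u (x - t • y) * potKernelDir b y) t := by
  have hk : IsBallKernel (potKernel : Euc n → ℝ) := isBallKernel_potKernel
  have hk1 : ContDiff ℝ 1 (potKernel : Euc n → ℝ) := contDiff_potKernel.of_le (by norm_num)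
  have hc2 : ∀ a b : Euc n, Continuous fun y => fderiv ℝ (fderiv ℝ u) (x - t • y) a b :=
    fun a b => (((continuous_fderiv_fderiv hu).comp (by fun_prop)).clm_apply
      continuous_const).clm_apply continuous_const
  convert hasDerivAt_average (hu.fderiv_apply_one b)
    (isBallKernel_ballKernel (k := 3) (by norm_num)) x t using 1
  simp_rw [← fderiv_potKernel]
  rw [← sum_average_swap hu contDiff_potKernel hk x b ht,
    ← integral_finsetSum _ fun i _ => (isBallKernel_fderiv hk1 hk _).integrable_mul (hc2 _ _)]
  refine integral_congr_ae (Eventually.of_forall fun y => ?_)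
  simp only
  rw [fderiv_fderiv_apply hu, fderiv_fderiv_symm hu, ← sum_coord_mul
    (fderiv ℝ (fderiv ℝ u) (x - t • y) b) y, ← Finset.sum_neg_distrib, Finset.sum_mul]
  refine Finset.sum_congr rfl fun i _ => ?_
  rw [fderiv_potKernel, potKernelDir, fderiv_fderiv_symm hu]; ring

lemma average_fderiv_fderiv (hu : ContDiff ℝ 2 u) (x a b : Euc n) {t : ℝ} (ht : t ≠ 0) :
    ∫ y, fderiv ℝ (fderiv ℝ u) (x - t • y) a b * ballKernel 3 y =
      t⁻¹ * ∫ y, fderiv ℝ u (x - t • y) b * fderiv ℝ (ballKernel 3) y a := by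
  rw [average_fderiv_kernel (hu.fderiv_apply_one b) (contDiff_ballKernel 1 3 (by norm_num))
    (isBallKernel_ballKernel (by norm_num)), inv_mul_cancel_left₀ ht]
  simp_rw [fderiv_fderiv_apply hu]

lemma hasDerivAt_average_fderiv_fderiv (hu : ContDiff ℝ 2 u) (x a b : Euc n) {t : ℝ}
    (ht : t ≠ 0) :
    HasDerivAt (fun t : ℝ => ∫ y, fderiv ℝ (fderiv ℝ u) (x - t • y) a b * ballKernel 3 y)
      (t⁻¹ * ∫ y, elaplacian u (x - t • y) * fderiv ℝ (potKernelDir a) y b) t := by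
  have hρ : IsBallKernel (ballKernel 3 : Euc n → ℝ) := isBallKernel_ballKernel (by norm_num)
  have hρ1 : ContDiff ℝ 1 (ballKernel 3 : Euc n → ℝ) := contDiff_ballKernel 1 3 (by norm_num)
  have hk : IsBallKernel (potKernelDir a) := isBallKernel_potKernelDir a
  have hk1 : ContDiff ℝ 1 (potKernelDir a) := (contDiff_potKernelDir a).of_le (by norm_num)
  have hc2 : ∀ a b : Euc n, Continuous fun y => fderiv ℝ (fderiv ℝ u) (x - t • y) a b :=
    fun a b => (((continuous_fderiv_fderiv hu).comp (by fun_prop)).clm_apply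
      continuous_const).clm_apply continuous_const
  have hc3 : Continuous fun y => -(fderiv ℝ (fun y => fderiv ℝ u y b) (x - t • y) y) :=
    ((((hu.fderiv_apply_one b).continuous_fderiv one_ne_zero).comp (by fun_prop)).clm_apply
      continuous_id).neg
  have h1 := (hasDerivAt_inv ht).mul (hasDerivAt_average (hu.fderiv_apply_one b)
    (isBallKernel_fderiv hρ1 hρ a) x t)
  refine (h1.congr_deriv ?_).congr_of_eventuallyEq ?_
  · have h2 := average_fderiv_fderiv hu x a b ht
    have hint : Integrable fun y =>
        -(fderiv ℝ (fderiv ℝ u) (x - t • y) a b * ballKernel 3 y) :=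
      (hρ.integrable_mul (hc2 a b)).neg
    rw [neg_mul, show (t ^ 2)⁻¹ = t⁻¹ * t⁻¹ by rw [sq, mul_inv], mul_assoc, ← h2, ← mul_neg,
      ← mul_add, ← sum_average_swap hu (contDiff_potKernelDir a) hk x b ht, ← integral_neg,
      ← integral_add hint
        ((isBallKernel_fderiv hρ1 hρ a).integrable_mul hc3),
      ← integral_finsetSum _ fun i _ => (isBallKernel_fderiv hk1 hk _).integrable_mul (hc2 _ _)]
    congr 1
    refine integral_congr_ae (Eventually.of_forall fun y => ?_)
    have e : ∀ i : Fin n, fderiv ℝ (fderiv ℝ u) (x - t • y) (EuclideanSpace.single i 1) b *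
        fderiv ℝ (potKernelDir a) y (EuclideanSpace.single i 1) =
        6 * ballKernel 2 y * inner ℝ y a * (fderiv ℝ (fderiv ℝ u) (x - t • y) b
          (EuclideanSpace.single i 1) * inner ℝ y (EuclideanSpace.single i 1)) -
        ballKernel 3 y * (fderiv ℝ (fderiv ℝ u) (x - t • y) b
          (EuclideanSpace.single i 1) * inner ℝ a (EuclideanSpace.single i 1)) := fun i => by
      rw [fderiv_potKernelDir, fderiv_fderiv_symm hu,
        real_inner_comm a (EuclideanSpace.single i 1)]
      ring
    simp only [e, Finset.sum_sub_distrib, ← Finset.mul_sum, sum_coord_mul,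
      fderiv_fderiv_apply hu, fderiv_ballKernel_three]
    rw [fderiv_fderiv_symm hu _ y b, fderiv_fderiv_symm hu _ a b]
    ring
  · filter_upwards [isOpen_ne.mem_nhds ht] with s hs
    exact average_fderiv_fderiv hu x a b hs

end Identities

lemma abs_sub_le_of_deriv_le {F B F' B' : ℝ → ℝ} {T : ℝ} (hT : 0 ≤ T)
    (hF : ContinuousOn F (Icc 0 T)) (hB : ContinuousOn B (Icc 0 T))
    (hF' : ∀ t ∈ Ioo 0 T, HasDerivAt F (F' t) t) (hB' : ∀ t ∈ Ioo 0 T, HasDerivAt B (B' t) t)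
    (h : ∀ t ∈ Ioo 0 T, |F' t| ≤ B' t) : |F T - F 0| ≤ B T - B 0 := by
  have h1 : MonotoneOn (fun t => B t - F t) (Icc 0 T) := by
    refine monotoneOn_of_deriv_nonneg (convex_Icc 0 T) (hB.sub hF) ?_ ?_ <;>
      rw [interior_Icc] <;> intro t ht
    · exact ((hB' t ht).sub (hF' t ht)).differentiableAt.differentiableWithinAt
    · rw [((hB' t ht).fun_sub (hF' t ht)).deriv]
      linarith [le_abs_self (F' t), h t ht]
  have h2 : MonotoneOn (fun t => B t + F t) (Icc 0 T) := by
    refine monotoneOn_of_deriv_nonneg (convex_Icc 0 T) (hB.add hF) ?_ ?_ <;>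
      rw [interior_Icc] <;> intro t ht
    · exact ((hB' t ht).add (hF' t ht)).differentiableAt.differentiableWithinAt
    · rw [((hB' t ht).fun_add (hF' t ht)).deriv]
      linarith [neg_abs_le (F' t), h t ht]
  have a := h1 (left_mem_Icc.2 hT) (right_mem_Icc.2 hT) hT
  have b := h2 (left_mem_Icc.2 hT) (right_mem_Icc.2 hT) hT
  simp only at a b
  rw [abs_le]
  constructor <;> linarith

section Estimates

variable {n : ℕ} {u : Euc n → ℝ}

lemma sub_smul_mem_ball {x y : Euc n} {t T : ℝ} (ht : 0 < t) (htT : t ≤ T) (hy : ‖y‖ < 1) :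
    x - t • y ∈ Metric.ball x T := by
  rw [Metric.mem_ball, dist_eq_norm, sub_sub_cancel_left, norm_neg, norm_smul,
    Real.norm_of_nonneg ht.le]
  nlinarith [norm_nonneg y]

lemma average_zero (F : Euc n → ℝ) (x : Euc n) :
    ∫ y, F (x - (0 : ℝ) • y) * ballKernel 3 y = F x * kernelMass n := by
  simp [kernelMass, integral_const_mul]

lemma average_le_of_superharmonic (hu : ContDiff ℝ 2 u) {x : Euc n} {T : ℝ} (hT : 0 ≤ T)
    (h : ∀ z ∈ Metric.ball x T, elaplacian u z ≤ 0) :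
    ∫ y, u (x - T • y) * ballKernel 3 y ≤ u x * kernelMass n := by
  have hd := hasDerivAt_average_laplacian hu x
  have hanti : AntitoneOn (fun t : ℝ => ∫ y, u (x - t • y) * ballKernel 3 y) (Icc 0 T) := by
    refine antitoneOn_of_deriv_nonpos (convex_Icc 0 T)
      (fun t _ => (hd t).continuousAt.continuousWithinAt)
      (fun t _ => (hd t).differentiableAt.differentiableWithinAt) fun t ht => ?_
    rw [interior_Icc] at ht
    rw [(hd t).deriv]
    refine mul_nonpos_of_nonneg_of_nonpos ht.1.le (integral_nonpos fun y => ?_)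
    rcases lt_or_ge ‖y‖ 1 with hy | hy
    · exact mul_nonpos_of_nonpos_of_nonneg (h _ (sub_smul_mem_ball ht.1 ht.2.le hy))
        (potKernel_nonneg y)
    · simp [potKernel_eq_zero hy]
  have := hanti (left_mem_Icc.2 hT) (right_mem_Icc.2 hT) hT
  simpa only [average_zero] using this

lemma abs_average_fderiv_sub_le (hu : ContDiff ℝ 2 u) {x : Euc n} (b : Euc n) {T M : ℝ}
    (hT : 0 ≤ T) (h : ∀ z ∈ Metric.ball x T, |elaplacian u z| ≤ M) :
    |(∫ y, fderiv ℝ u (x - T • y) b * ballKernel 3 y) - fderiv ℝ u x b * kernelMass n| ≤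
      T * (M * ‖b‖ * kernelMass n) := by
  have hρ : IsBallKernel (ballKernel 3 : Euc n → ℝ) := isBallKernel_ballKernel (by norm_num)
  have key := abs_sub_le_of_deriv_le (B := fun t => t * (M * ‖b‖ * kernelMass n))
    (B' := fun t => M * ‖b‖ * kernelMass n) hT
    (continuous_average (hu.fderiv_apply_one b) hρ x).continuousOn
    (by fun_prop) (fun t ht => hasDerivAt_average_fderiv hu x b ht.1.ne')
    (fun t _ => by simpa using (hasDerivAt_id t).mul_const (M * ‖b‖ * kernelMass n)) ?_
  · have h0 := average_zero (fun z => fderiv ℝ u z b) x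
    simp only [h0, zero_mul, sub_zero] at key
    exact key
  · intro t ht
    refine (abs_integral_kernel_le (G := fun _ => M * ‖b‖) (isBallKernel_potKernelDir b)
      continuous_const hρ fun y hy => ?_).trans_eq ?_
    · rw [abs_mul, mul_assoc]
      have h1 := h _ (sub_smul_mem_ball ht.1 ht.2.le hy)
      exact mul_le_mul h1 (abs_potKernelDir_le b y) (abs_nonneg _) ((abs_nonneg _).trans h1)
    · rw [integral_const_mul, kernelMass]

lemma average_fderiv_eq (hu : ContDiff ℝ 2 u) (x b : Euc n) {t : ℝ} (ht : t ≠ 0) :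
    ∫ y, fderiv ℝ u (x - t • y) b * ballKernel 3 y =
      t⁻¹ * ∫ y, u (x - t • y) * fderiv ℝ (ballKernel 3) y b := by
  rw [average_fderiv_kernel (hu.of_le (by norm_num)) (contDiff_ballKernel 1 3 (by norm_num))
    (isBallKernel_ballKernel (by norm_num)), inv_mul_cancel_left₀ ht]

/-- Interior gradient bound for positive superharmonic functions with bounded Laplacian. -/
lemma norm_fderiv_le_of_superharmonic (hu : ContDiff ℝ 2 u) {x : Euc n} {T M : ℝ}
    (hT : 0 < T) (hM : 0 ≤ M) (hpos : ∀ z ∈ Metric.ball x (2 * T), 0 ≤ u z)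
    (hsup : ∀ z ∈ Metric.ball x (2 * T), elaplacian u z ≤ 0)
    (h : ∀ z ∈ Metric.ball x T, |elaplacian u z| ≤ M) :
    ‖fderiv ℝ u x‖ ≤ T * M + 15 * 2 ^ n * u x / T := by
  have hZ := kernelMass_pos (n := n)
  have hux : 0 ≤ u x := hpos x (Metric.mem_ball_self (by positivity))
  refine ContinuousLinearMap.opNorm_le_bound _ (by positivity) fun b => ?_
  have h1 := abs_average_fderiv_sub_le hu b hT.le h
  rw [average_fderiv_eq hu x b hT.ne'] at h1
  have hcont : ∀ t : ℝ, Continuous fun y => u (x - t • y) := fun t =>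
    hu.continuous.comp (by fun_prop)
  have hρ : IsBallKernel (ballKernel 3 : Euc n → ℝ) := isBallKernel_ballKernel (by norm_num)
  have h2 : |∫ y, u (x - T • y) * fderiv ℝ (ballKernel 3) y b| ≤
      15 * ‖b‖ * (2 ^ n * (u x * kernelMass n)) := by
    rw [← Real.norm_eq_abs]
    have e1 : ∫ y, u (x - (2 * T) • ((1 / 2 : ℝ) • y)) * ballKernel 3 ((1 / 2 : ℝ) • y) =
        2 ^ n * ∫ y, u (x - (2 * T) • y) * ballKernel 3 y := by
      rw [Measure.integral_comp_smul volume
        (fun y => u (x - (2 * T) • y) * ballKernel 3 y) (1 / 2 : ℝ)]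
      simp
    have i1 : Integrable fun y : Euc n =>
        u (x - (2 * T) • ((1 / 2 : ℝ) • y)) * ballKernel 3 ((1 / 2 : ℝ) • y) :=
      (hρ.integrable_mul (hcont (2 * T))).comp_smul (by norm_num)
    refine (norm_integral_le_of_norm_le (i1.const_mul (15 * ‖b‖))
      (Eventually.of_forall fun y => ?_)).trans ?_
    · have e2 : (2 * T) • ((1 / 2 : ℝ) • y) = T • y := by
        rw [smul_smul]; congr 1; ring
      rw [e2, norm_mul, Real.norm_eq_abs (fderiv ℝ _ y b)]
      rcases lt_or_ge ‖y‖ 1 with hy | hy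
      · have hu0 := hpos (x - T • y) (sub_smul_mem_ball hT (by linarith) hy)
        rw [Real.norm_of_nonneg hu0]
        have := mul_le_mul_of_nonneg_left (abs_fderiv_ballKernel_three_le_dilate y b) hu0
        linarith
      · rw [fderiv_ballKernel_three_eq_zero b hy, abs_zero, mul_zero]
        rcases lt_or_ge ‖y‖ 2 with hy2 | hy2
        · have hm : x - (2 * T) • ((1 / 2 : ℝ) • y) ∈ Metric.ball x (2 * T) :=
            sub_smul_mem_ball (by positivity) le_rfl (by rw [norm_smul]; norm_num; linarith)
          rw [e2] at hm
          have := hpos _ hm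
          have := ballKernel_nonneg 3 ((1 / 2 : ℝ) • y)
          positivity
        · rw [ballKernel_eq_zero (by norm_num) (by rw [norm_smul]; norm_num; linarith)]
          simp
    · rw [integral_const_mul, e1]
      have := average_le_of_superharmonic hu (T := 2 * T) (by positivity) hsup
      gcongr
  have h3 : |T⁻¹ * ∫ y, u (x - T • y) * fderiv ℝ (ballKernel 3) y b| ≤
      T⁻¹ * (15 * ‖b‖ * (2 ^ n * (u x * kernelMass n))) := by
    rw [abs_mul, abs_of_pos (inv_pos.2 hT)]
    gcongr
  rw [Real.norm_eq_abs, ← mul_le_mul_iff_left₀ hZ]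
  calc |fderiv ℝ u x b| * kernelMass n = |fderiv ℝ u x b * kernelMass n| := by
        rw [abs_mul, abs_of_pos hZ]
    _ ≤ T * (M * ‖b‖ * kernelMass n) + T⁻¹ * (15 * ‖b‖ * (2 ^ n * (u x * kernelMass n))) := by
        have := abs_sub_abs_le_abs_sub (fderiv ℝ u x b * kernelMass n)
          (T⁻¹ * ∫ y, u (x - T • y) * fderiv ℝ (ballKernel 3) y b)
        rw [abs_sub_comm] at this
        linarith
    _ = _ := by field_simp

/-- Hölder continuity of the gradient for functions with bounded Laplacian. -/
lemma norm_fderiv_sub_le (hu : ContDiff ℝ 2 u) {x x' : Euc n} {K M : ℝ}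
    (hxx : ‖x - x'‖ ≤ 1) (hK : ∀ z ∈ Metric.ball x 2, ‖fderiv ℝ u z‖ ≤ K)
    (hM : ∀ z ∈ Metric.ball x 2, |elaplacian u z| ≤ M) :
    ‖fderiv ℝ u x - fderiv ℝ u x'‖ ≤
      (2 * M + 6 * K * volume.real (Metric.ball (0 : Euc n) 1) / kernelMass n) *
        √‖x - x'‖ := by
  have hZ := kernelMass_pos (n := n)
  have hx : x ∈ Metric.ball x 2 := Metric.mem_ball_self (by norm_num)
  have hK0 : 0 ≤ K := (norm_nonneg _).trans (hK x hx)
  have hM0 : 0 ≤ M := (abs_nonneg _).trans (hM x hx)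
  rcases eq_or_ne x x' with rfl | hne
  · simp
  set s := ‖x - x'‖ with hs
  have hs0 : 0 < s := norm_pos_iff.2 (sub_ne_zero.2 hne)
  set t := √s with htdef
  have ht : 0 < t := Real.sqrt_pos.2 hs0
  have ht1 : t ≤ 1 := Real.sqrt_le_one.2 hxx
  have htt : t * t = s := Real.mul_self_sqrt hs0.le
  set V := volume.real (Metric.ball (0 : Euc n) 1)
  have hV : 0 ≤ V := measureReal_nonneg
  have hsub : Metric.ball x' t ⊆ Metric.ball x 2 := by
    refine Metric.ball_subset_ball' ?_
    rw [dist_comm, dist_eq_norm]; linarith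
  refine ContinuousLinearMap.opNorm_le_bound _ (by positivity) fun b => ?_
  have h1 := abs_average_fderiv_sub_le hu b ht.le
    (fun z hz => hM z (Metric.ball_subset_ball (by linarith) hz))
  have h2 := abs_average_fderiv_sub_le hu b ht.le (fun z hz => hM z (hsub hz))
  have hcont : ∀ x : Euc n, Continuous fun y => u (x - t • y) := fun x =>
    hu.continuous.comp (by fun_prop)
  have hρ : IsBallKernel (fun y : Euc n => fderiv ℝ (ballKernel 3) y b) :=
    isBallKernel_fderiv (contDiff_ballKernel 1 3 (by norm_num))
      (isBallKernel_ballKernel (by norm_num)) b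
  have h3 : |(∫ y, fderiv ℝ u (x - t • y) b * ballKernel 3 y) -
      ∫ y, fderiv ℝ u (x' - t • y) b * ballKernel 3 y| ≤ t * (6 * K * ‖b‖ * V) := by
    rw [average_fderiv_eq hu x b ht.ne', average_fderiv_eq hu x' b ht.ne', ← mul_sub,
      ← integral_sub (hρ.integrable_mul (hcont x)) (hρ.integrable_mul (hcont x')), abs_mul,
      abs_of_pos (inv_pos.2 ht)]
    simp_rw [← sub_mul]
    have h4 := abs_integral_kernel_le_volume (F := fun y => u (x - t • y) - u (x' - t • y))
      (M := K * s * (6 * ‖b‖)) hρ fun y hy => ?_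
    · refine (mul_le_mul_of_nonneg_left h4 (inv_pos.2 ht).le).trans_eq ?_
      change t⁻¹ * (K * s * (6 * ‖b‖) * V) = _
      rw [← htt]; field_simp
    · rw [abs_mul]
      refine mul_le_mul ?_ (abs_fderiv_ballKernel_three_le y b) (abs_nonneg _) (by positivity)
      have := (convex_ball x 2).norm_image_sub_le_of_norm_fderiv_le (𝕜 := ℝ) (f := u) (C := K)
        (fun z _ => hu.differentiable (by norm_num) z) hK (hsub (sub_smul_mem_ball ht le_rfl hy))
        (sub_smul_mem_ball ht (by linarith) hy)
      rwa [sub_sub_sub_cancel_right] at this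
  rw [Real.norm_eq_abs, sub_apply, ← mul_le_mul_iff_left₀ hZ]
  calc |fderiv ℝ u x b - fderiv ℝ u x' b| * kernelMass n
      = |fderiv ℝ u x b * kernelMass n - fderiv ℝ u x' b * kernelMass n| := by
        rw [← sub_mul, abs_mul, abs_of_pos hZ]
    _ ≤ t * (M * ‖b‖ * kernelMass n) + t * (6 * K * ‖b‖ * V) +
          t * (M * ‖b‖ * kernelMass n) := by
        rw [abs_le] at *
        constructor <;> linarith
    _ = _ := by field_simp; ring

lemma abs_average_fderiv_fderiv_sub_le (hu : ContDiff ℝ 2 u) {x : Euc n} (a b : Euc n)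
    {T H α : ℝ} (hT : 0 ≤ T) (hH0 : 0 ≤ H) (hα : 0 < α)
    (hH : ∀ z ∈ Metric.ball x T, |elaplacian u z - elaplacian u x| ≤ H * ‖z - x‖ ^ α) :
    |(∫ y, fderiv ℝ (fderiv ℝ u) (x - T • y) a b * ballKernel 3 y) -
        fderiv ℝ (fderiv ℝ u) x a b * kernelMass n| ≤
      7 * H * ‖a‖ * ‖b‖ * volume.real (Metric.ball (0 : Euc n) 1) / α * T ^ α := by
  set V := volume.real (Metric.ball (0 : Euc n) 1)
  have hρ : IsBallKernel (ballKernel 3 : Euc n → ℝ) := isBallKernel_ballKernel (by norm_num)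
  have hk : IsBallKernel (potKernelDir a) := isBallKernel_potKernelDir a
  have hk1 : ContDiff ℝ 1 (potKernelDir a) := (contDiff_potKernelDir a).of_le (by norm_num)
  have hkb := isBallKernel_fderiv hk1 hk b
  have hc : Continuous fun t : ℝ =>
      ∫ y, fderiv ℝ (fderiv ℝ u) (x - t • y) a b * ballKernel 3 y := by
    have h2 : Continuous fun p : ℝ × Euc n =>
        fderiv ℝ (fderiv ℝ u) (x - p.1 • p.2) a b * ballKernel 3 p.2 :=
      ((((continuous_fderiv_fderiv hu).comp (by fun_prop)).clm_apply
        continuous_const).clm_apply continuous_const).mul (hρ.continuous.comp continuous_snd)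
    have h3 := continuous_parametric_integral_of_continuous (μ := volume)
      (f := fun (t : ℝ) (y : Euc n) =>
        fderiv ℝ (fderiv ℝ u) (x - t • y) a b * ballKernel 3 y) h2
      (isCompact_closedBall (0 : Euc n) 1)
    refine h3.congr fun t => ?_
    refine setIntegral_eq_integral_of_forall_compl_eq_zero fun y hy => ?_
    rw [hρ.eq_zero y (by simpa using (le_of_lt (by simpa using hy))), mul_zero]
  have key := abs_sub_le_of_deriv_le (B := fun t => 7 * H * ‖a‖ * ‖b‖ * V / α * t ^ α)
    (B' := fun t => 7 * H * ‖a‖ * ‖b‖ * V * t ^ (α - 1)) hT hc.continuousOn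
    (continuous_const.mul (Real.continuous_rpow_const hα.le)).continuousOn
    (fun t ht => hasDerivAt_average_fderiv_fderiv hu x a b ht.1.ne')
    (fun t ht => by
      have := (Real.hasDerivAt_rpow_const (x := t) (p := α) (Or.inl ht.1.ne')).const_mul
        (7 * H * ‖a‖ * ‖b‖ * V / α)
      refine this.congr_deriv ?_
      field_simp) ?_
  · have h0 := average_zero (fun z => fderiv ℝ (fderiv ℝ u) z a b) x
    simp only [h0, Real.zero_rpow hα.ne', mul_zero, sub_zero] at key
    exact key
  · intro t ht
    have e : ∫ y, elaplacian u (x - t • y) * fderiv ℝ (potKernelDir a) y b =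
        ∫ y, (elaplacian u (x - t • y) - elaplacian u x) * fderiv ℝ (potKernelDir a) y b := by
      have hcl : Continuous fun y : Euc n => elaplacian u (x - t • y) :=
        (continuous_elaplacian hu).comp (by fun_prop)
      simp_rw [sub_mul]
      rw [integral_sub (hkb.integrable_mul hcl)
        (hkb.integrable_mul continuous_const), integral_const_mul,
        integral_fderiv_kernel hk1 hk b, mul_zero, sub_zero]
    have h1 := abs_integral_kernel_le_volume (F := fun y => elaplacian u (x - t • y) -
      elaplacian u x) (M := H * t ^ α * (7 * ‖a‖ * ‖b‖)) hkb fun y hy => ?_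
    · rw [e, abs_mul, abs_of_pos (inv_pos.2 ht.1)]
      refine (mul_le_mul_of_nonneg_left h1 (inv_pos.2 ht.1).le).trans_eq ?_
      change t⁻¹ * (H * t ^ α * (7 * ‖a‖ * ‖b‖) * V) = _
      rw [Real.rpow_sub_one ht.1.ne']
      field_simp
    · rw [abs_mul]
      have h2 := hH _ (sub_smul_mem_ball (x := x) ht.1 ht.2.le hy)
      rw [sub_sub_cancel_left, norm_neg, norm_smul, Real.norm_of_nonneg ht.1.le] at h2
      have h3 : (t * ‖y‖) ^ α ≤ t ^ α :=
        Real.rpow_le_rpow (mul_nonneg ht.1.le (norm_nonneg y))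
          (mul_le_of_le_one_right ht.1.le hy.le) hα.le
      exact mul_le_mul (h2.trans (mul_le_mul_of_nonneg_left h3 hH0))
        (abs_fderiv_potKernelDir_le a y b) (abs_nonneg _)
        (mul_nonneg hH0 (Real.rpow_nonneg ht.1.le α))

/-- Interior Schauder type bound for the second derivative. -/
lemma norm_fderiv_fderiv_le (hu : ContDiff ℝ 2 u) {x : Euc n} {K H α : ℝ}
    (hH0 : 0 ≤ H) (hα : 0 < α) (hK : ∀ z ∈ Metric.ball x 1, ‖fderiv ℝ u z‖ ≤ K)
    (hH : ∀ z ∈ Metric.ball x 1, |elaplacian u z - elaplacian u x| ≤ H * ‖z - x‖ ^ α) :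
    ‖fderiv ℝ (fderiv ℝ u) x‖ ≤
      (7 * H / α + 6 * K) * volume.real (Metric.ball (0 : Euc n) 1) / kernelMass n := by
  have hZ := kernelMass_pos (n := n)
  have hK0 : 0 ≤ K := (norm_nonneg _).trans (hK x (Metric.mem_ball_self (by norm_num)))
  set V := volume.real (Metric.ball (0 : Euc n) 1) with hV'
  have hV : 0 ≤ V := measureReal_nonneg
  refine ContinuousLinearMap.opNorm_le_bound₂ _ (by positivity) fun a b => ?_
  have h1 := abs_average_fderiv_fderiv_sub_le hu a b zero_le_one hH0 hα hH
  rw [average_fderiv_fderiv hu x a b one_ne_zero, inv_one, one_mul, Real.one_rpow, ← hV',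
    mul_one] at h1
  have hρ : IsBallKernel (fun y : Euc n => fderiv ℝ (ballKernel 3) y a) :=
    isBallKernel_fderiv (contDiff_ballKernel 1 3 (by norm_num))
      (isBallKernel_ballKernel (by norm_num)) a
  have h2 := abs_integral_kernel_le_volume (F := fun y => fderiv ℝ u (x - (1 : ℝ) • y) b)
    (M := K * ‖b‖ * (6 * ‖a‖)) hρ fun y hy => by
      rw [abs_mul]
      refine mul_le_mul ?_ (abs_fderiv_ballKernel_three_le y a) (abs_nonneg _) (by positivity)
      exact (ContinuousLinearMap.le_opNorm _ _).trans (mul_le_mul_of_nonneg_right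
        (hK _ (sub_smul_mem_ball one_pos le_rfl hy)) (norm_nonneg b))
  rw [← hV'] at h2
  rw [Real.norm_eq_abs, ← mul_le_mul_iff_left₀ hZ]
  calc |fderiv ℝ (fderiv ℝ u) x a b| * kernelMass n
      = |fderiv ℝ (fderiv ℝ u) x a b * kernelMass n| := by rw [abs_mul, abs_of_pos hZ]
    _ ≤ 7 * H * ‖a‖ * ‖b‖ * V / α + K * ‖b‖ * (6 * ‖a‖) * V := by
        rw [abs_le] at *
        constructor <;> linarith
    _ = _ := by field_simp

/-- Interior Schauder type Hölder bound for the second derivative. -/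
lemma norm_fderiv_fderiv_sub_le (hu : ContDiff ℝ 2 u) {x x' : Euc n} {A H α : ℝ}
    (hxx : ‖x - x'‖ ≤ 1) (hA0 : 0 ≤ A) (hH0 : 0 ≤ H) (hα : 0 < α) (hα1 : α ≤ 1)
    (hA : ∀ z ∈ Metric.ball x 2, ∀ z' ∈ Metric.ball x 2, ‖z - z'‖ ≤ 1 →
      ‖fderiv ℝ u z - fderiv ℝ u z'‖ ≤ A * √‖z - z'‖)
    (hH : ∀ z ∈ Metric.ball x 2, ∀ z' ∈ Metric.ball x 2, ‖z - z'‖ ≤ 1 →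
      |elaplacian u z - elaplacian u z'| ≤ H * ‖z - z'‖ ^ α) :
    ‖fderiv ℝ (fderiv ℝ u) x - fderiv ℝ (fderiv ℝ u) x'‖ ≤
      (14 * H / α + 6 * A) * volume.real (Metric.ball (0 : Euc n) 1) / kernelMass n *
        ‖x - x'‖ ^ (α / 4) := by
  have hZ := kernelMass_pos (n := n)
  rcases eq_or_ne x x' with rfl | hne
  · rw [sub_self, norm_zero (E := Euc n →L[ℝ] Euc n →L[ℝ] ℝ)]
    have := measureReal_nonneg (μ := volume) (s := Metric.ball (0 : Euc n) 1)
    positivity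
  set V := volume.real (Metric.ball (0 : Euc n) 1) with hV'
  have hV : 0 ≤ V := measureReal_nonneg
  set s := ‖x - x'‖ with hs
  have hs0 : 0 < s := norm_pos_iff.2 (sub_ne_zero.2 hne)
  set t := s ^ (1 / 4 : ℝ) with htdef
  have ht : 0 < t := Real.rpow_pos_of_pos hs0 _
  have ht1 : t ≤ 1 := Real.rpow_le_one hs0.le hxx (by norm_num)
  have htt : √s = t * t := by
    rw [Real.sqrt_eq_rpow, htdef, ← Real.rpow_add hs0]; norm_num
  have htα : s ^ (α / 4) = t ^ α := by
    rw [htdef, ← Real.rpow_mul hs0.le]; congr 1; ring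
  have htt' : t ≤ t ^ α := by
    simpa using Real.rpow_le_rpow_of_exponent_ge ht ht1 hα1
  have hsub : Metric.ball x' t ⊆ Metric.ball x 2 := by
    refine Metric.ball_subset_ball' ?_
    rw [dist_comm, dist_eq_norm]; linarith
  have hsub' : Metric.ball x t ⊆ Metric.ball x 2 := Metric.ball_subset_ball (by linarith)
  have hx'x : x' ∈ Metric.ball x 2 := hsub (Metric.mem_ball_self ht)
  refine ContinuousLinearMap.opNorm_le_bound₂ _ (by positivity) fun a b => ?_
  have h1 := abs_average_fderiv_fderiv_sub_le hu a b ht.le hH0 hα fun z hz =>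
    hH z (hsub' hz) x (Metric.mem_ball_self two_pos)
      (by rw [← dist_eq_norm]; exact (Metric.mem_ball.1 hz).le.trans ht1)
  have h2 := abs_average_fderiv_fderiv_sub_le hu a b ht.le hH0 hα fun z hz =>
    hH z (hsub hz) x' hx'x
      (by rw [← dist_eq_norm]; exact (Metric.mem_ball.1 hz).le.trans ht1)
  rw [← hV'] at h1 h2
  have hcont : ∀ x : Euc n, Continuous fun y => fderiv ℝ u (x - t • y) b := fun x =>
    (hu.fderiv_apply_one b).continuous.comp (by fun_prop)
  have hρ : IsBallKernel (fun y : Euc n => fderiv ℝ (ballKernel 3) y a) :=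
    isBallKernel_fderiv (contDiff_ballKernel 1 3 (by norm_num))
      (isBallKernel_ballKernel (by norm_num)) a
  have h3 : |(∫ y, fderiv ℝ (fderiv ℝ u) (x - t • y) a b * ballKernel 3 y) -
      ∫ y, fderiv ℝ (fderiv ℝ u) (x' - t • y) a b * ballKernel 3 y| ≤
      t ^ α * (6 * A * ‖a‖ * ‖b‖ * V) := by
    rw [average_fderiv_fderiv hu x a b ht.ne', average_fderiv_fderiv hu x' a b ht.ne',
      ← mul_sub, ← integral_sub (hρ.integrable_mul (hcont x)) (hρ.integrable_mul (hcont x')),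
      abs_mul, abs_of_pos (inv_pos.2 ht)]
    simp_rw [← sub_mul]
    have h4 := abs_integral_kernel_le_volume
      (F := fun y => fderiv ℝ u (x - t • y) b - fderiv ℝ u (x' - t • y) b)
      (M := A * (t * t) * ‖b‖ * (6 * ‖a‖)) hρ fun y hy => ?_
    · refine (mul_le_mul_of_nonneg_left h4 (inv_pos.2 ht).le).trans ?_
      refine le_trans (le_of_eq ?_) (mul_le_mul_of_nonneg_right htt' (by positivity))
      change t⁻¹ * (A * (t * t) * ‖b‖ * (6 * ‖a‖) * V) = _
      field_simp
    · rw [abs_mul]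
      refine mul_le_mul ?_ (abs_fderiv_ballKernel_three_le y a) (abs_nonneg _) (by positivity)
      have h5 := hA _ (sub_smul_mem_ball (x := x) ht (by linarith) hy) _
        (hsub (sub_smul_mem_ball ht le_rfl hy))
        (by rw [sub_sub_sub_cancel_right]; exact hxx)
      rw [sub_sub_sub_cancel_right, ← hs, htt] at h5
      rw [← sub_apply, ← Real.norm_eq_abs]
      exact (ContinuousLinearMap.le_opNorm _ _).trans
        (mul_le_mul_of_nonneg_right h5 (norm_nonneg b))
  rw [Real.norm_eq_abs, sub_apply, sub_apply, htα, ← mul_le_mul_iff_left₀ hZ]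
  calc |fderiv ℝ (fderiv ℝ u) x a b - fderiv ℝ (fderiv ℝ u) x' a b| * kernelMass n
      = |fderiv ℝ (fderiv ℝ u) x a b * kernelMass n -
          fderiv ℝ (fderiv ℝ u) x' a b * kernelMass n| := by
        rw [← sub_mul, abs_mul, abs_of_pos hZ]
    _ ≤ 7 * H * ‖a‖ * ‖b‖ * V / α * t ^ α + t ^ α * (6 * A * ‖a‖ * ‖b‖ * V) +
          7 * H * ‖a‖ * ‖b‖ * V / α * t ^ α := by
        rw [abs_le] at *
        constructor <;> linarith
    _ = _ := by field_simp; ring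

end Estimates

lemma rpow_sub_rpow_le {q s M : ℝ} (hq : 0 < q) (hs : 0 ≤ s) (hsM : s ≤ M) (hM : 1 ≤ M)
    (hM2 : M ≤ 2) : M ^ q - s ^ q ≤ 2 ^ q * (q + 1) * (M - s) := by
  have hM0 : 0 < M := by linarith
  set r := s / M with hr
  have hr0 : 0 ≤ r := by positivity
  have hr1 : r ≤ 1 := (div_le_one hM0).2 hsM
  have hsr : s = M * r := by rw [hr]; field_simp
  have h1 : 1 - r ^ q ≤ (q + 1) * (1 - r) := by
    rcases le_total q 1 with h | h
    · have : r ≤ r ^ q := by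
        rcases hr0.eq_or_lt with h0 | h0
        · rw [← h0, Real.zero_rpow hq.ne']
        · simpa using Real.rpow_le_rpow_of_exponent_ge h0 hr1 h
      nlinarith
    · have := one_add_mul_self_le_rpow_one_add (s := r - 1) (by linarith) h
      rw [add_sub_cancel] at this
      nlinarith
  have h2 : M ^ q ≤ 2 ^ q := Real.rpow_le_rpow hM0.le hM2 hq.le
  have h3 : 0 ≤ (q + 1) * (1 - r) := mul_nonneg (by linarith) (by linarith)
  calc M ^ q - s ^ q = M ^ q * (1 - r ^ q) := by rw [hsr, Real.mul_rpow hM0.le hr0]; ring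
    _ ≤ M ^ q * ((q + 1) * (1 - r)) := by gcongr
    _ ≤ 2 ^ q * ((q + 1) * (1 - r)) := by gcongr
    _ ≤ 2 ^ q * ((q + 1) * (1 - r)) * M := le_mul_of_one_le_right (by positivity) hM
    _ = _ := by rw [hsr]; ring

lemma linear_gronwall {Ψ Ψ' : ℝ → ℝ} {A C : ℝ} (hC : 0 < C) (hc : ContinuousOn Ψ (Icc 0 1))
    (hd : ∀ t ∈ Ioo (0 : ℝ) 1, HasDerivAt Ψ (Ψ' t) t)
    (h : ∀ t ∈ Ioo (0 : ℝ) 1, Ψ' t ≤ A + C * Ψ t) :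
    Ψ 1 + A / C ≤ (Ψ 0 + A / C) * Real.exp C := by
  have hD : ∀ t ∈ Ioo (0 : ℝ) 1, HasDerivAt (fun t => (Ψ t + A / C) * Real.exp (-C * t))
      (Ψ' t * Real.exp (-C * t) + (Ψ t + A / C) * (Real.exp (-C * t) * (-C * 1))) t :=
    fun t ht => ((hd t ht).add_const _).mul (((hasDerivAt_id t).const_mul (-C)).exp)
  have hanti : AntitoneOn (fun t => (Ψ t + A / C) * Real.exp (-C * t)) (Icc 0 1) := by
    refine antitoneOn_of_deriv_nonpos (convex_Icc 0 1)
      ((hc.add continuousOn_const).mul (by fun_prop)) ?_ ?_ <;> rw [interior_Icc] <;> intro t ht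
    · exact (hD t ht).differentiableAt.differentiableWithinAt
    · rw [(hD t ht).deriv]
      have e : Ψ' t * Real.exp (-C * t) + (Ψ t + A / C) * (Real.exp (-C * t) * (-C * 1)) =
          Real.exp (-C * t) * (Ψ' t - (A + C * Ψ t)) := by field_simp; ring
      rw [e]
      exact mul_nonpos_of_nonneg_of_nonpos (Real.exp_pos _).le (by linarith [h t ht])
  have := hanti (left_mem_Icc.2 zero_le_one) (right_mem_Icc.2 zero_le_one) zero_le_one
  simp only [mul_one, mul_zero, Real.exp_zero] at this
  rw [Real.exp_neg, ← div_eq_mul_inv, div_le_iff₀ (Real.exp_pos C)] at this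
  exact this

section Rigidity

variable {n : ℕ}

lemma norm_sub_innerSL_sq (l : Euc n →L[ℝ] ℝ) (b : Euc n) :
    ‖l - innerSL ℝ b‖ ^ 2 = ‖l‖ ^ 2 + ‖b‖ ^ 2 - 2 * l b := by
  obtain ⟨g, rfl⟩ : ∃ g, innerSL ℝ g = l :=
    ⟨(InnerProductSpace.toDual ℝ (Euc n)).symm l,
      (InnerProductSpace.toDual ℝ (Euc n)).apply_symm_apply l⟩
  rw [← map_sub, innerSL_apply_norm, innerSL_apply_norm, innerSL_apply_apply, norm_sub_sq_real]
  ring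

lemma integral_potKernelDir (b : Euc n) : ∫ y, potKernelDir b y = 0 := by
  simpa only [fderiv_potKernel] using integral_fderiv_kernel
    (contDiff_potKernel.of_le (by norm_num)) (isBallKernel_potKernel (n := n)) b

lemma average_fderiv_radial {w : Euc n → ℝ} (hw : ContDiff ℝ 2 w) :
    ∫ y, -(elaplacian w (0 - (1 : ℝ) • y)) * potKernel y =
      ∫ y, fderiv ℝ w (0 - (1 : ℝ) • y) y * ballKernel 3 y := by
  have h := (hasDerivAt_average (hw.of_le (by norm_num))
    (isBallKernel_ballKernel (k := 3) (by norm_num)) 0 1).unique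
    (hasDerivAt_average_laplacian hw 0 1)
  simp_rw [neg_mul, integral_neg] at h ⊢
  linarith

set_option maxHeartbeats 1000000 in
/-- A function whose gradient nearly attains its maximal norm at the centre of a ball cannot
be close to a solution of the eikonal-type equation `-Δw = |∇w|^q`. -/
lemma exists_pos_no_almost_maximal_gradient (n : ℕ) {q : ℝ} (hq : 0 < q) :
    ∃ δ > 0, ∀ w : Euc n → ℝ, ContDiff ℝ 2 w → ‖fderiv ℝ w 0‖ = 1 →
      (∀ x ∈ Metric.ball (0 : Euc n) 1, ‖fderiv ℝ w x‖ ≤ 1 + δ) →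
      (∀ x ∈ Metric.ball (0 : Euc n) 1, |elaplacian w x + ‖fderiv ℝ w x‖ ^ q| ≤ δ) →
      False := by
  have hZ := kernelMass_pos (n := n)
  have hP := integral_potKernel_pos (n := n)
  set Z := kernelMass n with hZdef
  set P := ∫ y : Euc n, potKernel y with hPdef
  set C : ℝ := 2 ^ q * (q + 1) with hCdef
  have hC1 : 1 ≤ C := by
    have : (1 : ℝ) ≤ 2 ^ q := Real.one_le_rpow (by norm_num) hq.le
    nlinarith
  set S : ℝ := 1 + 2 * Real.exp C + 2 * C * Real.exp C with hSdef
  have hS : 0 < S := by positivity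
  set κ : ℝ := min (1 / 2) (P / (2 * Z * S)) with hκdef
  have hκ0 : 0 < κ := by positivity
  have hκ1 : κ ≤ 1 / 2 := min_le_left _ _
  have hκ2 : κ * Z * S ≤ P / 2 := by
    have : κ ≤ P / (2 * Z * S) := min_le_right _ _
    rw [le_div_iff₀ (by positivity)] at this
    linarith
  refine ⟨κ ^ 2, by positivity, fun w hw hw0 hle hL => ?_⟩
  have hδ1 : κ ^ 2 ≤ 1 := by nlinarith
  set M : ℝ := 1 + κ ^ 2 with hMdef
  have hM1 : 1 ≤ M := by nlinarith [sq_nonneg κ]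
  have hM2 : M ≤ 2 := by linarith
  set b : Euc n := (InnerProductSpace.toDual ℝ (Euc n)).symm (fderiv ℝ w 0) with hb
  have hbn : ‖b‖ = 1 := by rw [hb, LinearIsometryEquiv.norm_map, hw0]
  have hwb : fderiv ℝ w 0 b = 1 := by
    have : fderiv ℝ w 0 b = inner ℝ b b := by
      rw [hb, InnerProductSpace.toDual_symm_apply]
    rw [this, real_inner_self_eq_norm_sq, hbn, one_pow]
  have hρ : IsBallKernel (ballKernel 3 : Euc n → ℝ) := isBallKernel_ballKernel (by norm_num)
  have hp : IsBallKernel (potKernel : Euc n → ℝ) := isBallKernel_potKernel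
  have hkd : IsBallKernel (potKernelDir b) := isBallKernel_potKernelDir b
  have hDb : ∀ z, fderiv ℝ w z b ≤ ‖fderiv ℝ w z‖ := fun z => by
    have := (fderiv ℝ w z).le_opNorm b
    rw [hbn, mul_one] at this
    exact (le_abs_self _).trans this
  have hlap : ∀ z ∈ Metric.ball (0 : Euc n) 1,
      |elaplacian w z + M ^ q| ≤ κ ^ 2 + C * (M - fderiv ℝ w z b) := fun z hz => by
    have h1 := rpow_sub_rpow_le hq (norm_nonneg _) (hle z hz) hM1 hM2
    have h2 : C * (M - ‖fderiv ℝ w z‖) ≤ C * (M - fderiv ℝ w z b) := by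
      have := hDb z
      gcongr
    have h3 := hL z hz
    have h4 : ‖fderiv ℝ w z‖ ^ q ≤ M ^ q := Real.rpow_le_rpow (norm_nonneg _) (hle z hz) hq.le
    rw [abs_le] at h3 ⊢
    constructor <;> linarith
  have hcl : ∀ t : ℝ, Continuous fun y : Euc n => elaplacian w (0 - t • y) := fun t =>
    (continuous_elaplacian hw).comp (by fun_prop)
  have hcD : ∀ t : ℝ, Continuous fun y : Euc n => fderiv ℝ w (0 - t • y) b := fun t =>
    (hw.fderiv_apply_one b).continuous.comp (by fun_prop)
  have hcM : ∀ t : ℝ, Continuous fun y : Euc n => M - fderiv ℝ w (0 - t • y) b := fun t =>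
    continuous_const.sub (hcD t)
  set Ψ : ℝ → ℝ := fun t => M * Z - ∫ y, fderiv ℝ w (0 - t • y) b * ballKernel 3 y with hΨ
  have hΨint : ∀ t, ∫ y, (M - fderiv ℝ w (0 - t • y) b) * ballKernel 3 y = Ψ t := fun t => by
    simp_rw [sub_mul]
    rw [integral_sub (hρ.integrable_mul continuous_const) (hρ.integrable_mul (hcD t)),
      integral_const_mul]
    rfl
  have hΨ0 : Ψ 0 = κ ^ 2 * Z := by
    have := average_zero (fun z => fderiv ℝ w z b) 0
    simp only [hΨ, this, hwb]
    rw [hMdef]; ring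
  have hgr := linear_gronwall (Ψ := Ψ) (A := κ ^ 2 * Z) (C := C) (by linarith)
    (Ψ' := fun t => -∫ y, elaplacian w (0 - t • y) * potKernelDir b y)
    (continuous_const.sub (continuous_average (hw.fderiv_apply_one b) hρ 0)).continuousOn
    (fun t ht => (hasDerivAt_average_fderiv hw 0 b ht.1.ne').const_sub (M * Z)) (by
      intro t ht
      have e : ∫ y, elaplacian w (0 - t • y) * potKernelDir b y =
          ∫ y, (elaplacian w (0 - t • y) + M ^ q) * potKernelDir b y := by
        simp_rw [add_mul]
        rw [integral_add (hkd.integrable_mul (hcl t)) (hkd.integrable_mul continuous_const),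
          integral_const_mul, integral_potKernelDir, mul_zero, add_zero]
      have h1 := abs_integral_kernel_le (F := fun y => elaplacian w (0 - t • y) + M ^ q)
        (G := fun y => κ ^ 2 + C * (M - fderiv ℝ w (0 - t • y) b)) hkd
        (continuous_const.add (continuous_const.mul (hcM t))) hρ
        fun y hy => by
          rw [abs_mul]
          have h2 := hlap _ (sub_smul_mem_ball (x := 0) ht.1 ht.2.le hy)
          have h3 := abs_potKernelDir_le b y
          rw [hbn, one_mul] at h3
          exact mul_le_mul h2 h3 (abs_nonneg _) ((abs_nonneg _).trans h2)
      have h4 : ∫ y, (κ ^ 2 + C * (M - fderiv ℝ w (0 - t • y) b)) * ballKernel 3 y =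
          κ ^ 2 * Z + C * Ψ t := by
        rw [← hΨint t, ← integral_const_mul, hZdef, kernelMass, ← integral_const_mul,
          ← integral_add (hρ.integrable.const_mul _)
            ((hρ.integrable_mul (hcM t)).const_mul _)]
        congr 1; ext y; ring
      rw [h4, ← e] at h1
      linarith [neg_abs_le (∫ y, elaplacian w (0 - t • y) * potKernelDir b y)])
  have hΨ1 : Ψ 1 ≤ 2 * κ ^ 2 * Z * Real.exp C := by
    rw [hΨ0] at hgr
    have h1 : κ ^ 2 * Z / C ≤ κ ^ 2 * Z := div_le_self (by positivity) hC1
    have h2 : 0 ≤ κ ^ 2 * Z / C := by positivity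
    have h3 := mul_le_mul_of_nonneg_right h1 (Real.exp_pos C).le
    linarith
  have hlow : (1 - κ ^ 2) * P - C * Ψ 1 ≤
      ∫ y, -(elaplacian w (0 - (1 : ℝ) • y)) * potKernel y := by
    have h1 := abs_integral_kernel_le (F := fun y => M - fderiv ℝ w (0 - (1 : ℝ) • y) b)
      (G := fun y => M - fderiv ℝ w (0 - (1 : ℝ) • y) b) hp
      (hcM 1) hρ fun y hy => by
        have hz := sub_smul_mem_ball (x := (0 : Euc n)) one_pos le_rfl hy
        have h2 : 0 ≤ M - fderiv ℝ w (0 - (1 : ℝ) • y) b := by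
          linarith [hDb (0 - (1 : ℝ) • y), hle _ hz]
        rw [abs_of_nonneg (mul_nonneg h2 (potKernel_nonneg y))]
        exact mul_le_mul_of_nonneg_left (potKernel_le y) h2
    rw [hΨint] at h1
    have h2 := le_of_abs_le h1
    have h3 : ∫ y, (1 - κ ^ 2 - C * (M - fderiv ℝ w (0 - (1 : ℝ) • y) b)) * potKernel y ≤
        ∫ y, -(elaplacian w (0 - (1 : ℝ) • y)) * potKernel y := by
      refine integral_kernel_mono
        (continuous_const.sub (continuous_const.mul (hcM 1))) hp
        (hcl 1).neg hp fun y hy => mul_le_mul_of_nonneg_right ?_ (potKernel_nonneg y)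
      have h4 := le_of_abs_le (hlap _ (sub_smul_mem_ball (x := 0) one_pos le_rfl hy))
      have h5 : 1 ≤ M ^ q := Real.one_le_rpow hM1 hq.le
      linarith
    have h6 : ∫ y, (1 - κ ^ 2 - C * (M - fderiv ℝ w (0 - (1 : ℝ) • y) b)) * potKernel y =
        (1 - κ ^ 2) * P - C * ∫ y, (M - fderiv ℝ w (0 - (1 : ℝ) • y) b) * potKernel y := by
      rw [hPdef, ← integral_const_mul, ← integral_const_mul,
        ← integral_sub (hp.integrable.const_mul _)
          ((hp.integrable_mul (hcM 1)).const_mul _)]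
      congr 1; ext y; ring
    have h7 := mul_le_mul_of_nonneg_left h2 (by linarith : 0 ≤ C)
    linarith
  have hup : ∫ y, fderiv ℝ w (0 - (1 : ℝ) • y) y * ballKernel 3 y ≤
      κ * Z + Ψ 1 / κ := by
    have hcy : Continuous fun y : Euc n => fderiv ℝ w (0 - (1 : ℝ) • y) y :=
      (hw.fderiv_one.continuous.comp (by fun_prop)).clm_apply continuous_id
    have h1 : ∫ y, (fderiv ℝ w (0 - (1 : ℝ) • y) y - inner ℝ y b) * ballKernel 3 y =
        ∫ y, fderiv ℝ w (0 - (1 : ℝ) • y) y * ballKernel 3 y := by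
      simp_rw [sub_mul]
      rw [integral_sub (hρ.integrable_mul hcy) (hρ.integrable_mul (by fun_prop))]
      have := integral_potKernelDir b
      simp_rw [potKernelDir, integral_neg, neg_eq_zero, mul_comm (ballKernel 3 _)] at this
      rw [this, sub_zero]
    have h2 : ∫ y, (κ + (M - fderiv ℝ w (0 - (1 : ℝ) • y) b) / κ) * ballKernel 3 y =
        κ * Z + Ψ 1 / κ := by
      rw [← hΨint 1, div_eq_inv_mul, ← integral_const_mul, hZdef, kernelMass,
        ← integral_const_mul, ← integral_add (hρ.integrable.const_mul _)
          ((hρ.integrable_mul (hcM 1)).const_mul _)]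
      congr 1; ext y; ring
    rw [← h1, ← h2]
    refine integral_kernel_mono (hcy.sub (by fun_prop)) hρ
      (continuous_const.add ((hcM 1).div_const _)) hρ
      fun y hy => mul_le_mul_of_nonneg_right ?_ (ballKernel_nonneg 3 y)
    set z := (0 : Euc n) - (1 : ℝ) • y with hz
    have hzb : z ∈ Metric.ball (0 : Euc n) 1 := sub_smul_mem_ball one_pos le_rfl hy
    set X := ‖fderiv ℝ w z - innerSL ℝ b‖ with hX
    have hX0 : 0 ≤ X := norm_nonneg _
    have hX2 : X ^ 2 ≤ κ ^ 4 + 2 * (M - fderiv ℝ w z b) := by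
      rw [hX, norm_sub_innerSL_sq, hbn]
      have := pow_le_pow_left₀ (norm_nonneg _) (hle z hzb) 2
      nlinarith
    have h3 : fderiv ℝ w z y - inner ℝ y b ≤ X := by
      have h4 := (fderiv ℝ w z - innerSL ℝ b).le_opNorm y
      have h5 : (fderiv ℝ w z - innerSL ℝ b) y = fderiv ℝ w z y - inner ℝ y b := by
        rw [sub_apply, innerSL_apply_apply, real_inner_comm]
      rw [h5] at h4
      exact (le_abs_self _).trans (h4.trans (mul_le_of_le_one_right hX0 hy.le))
    refine h3.trans ?_
    rw [← mul_le_mul_iff_left₀ hκ0, add_mul, div_mul_cancel₀ _ hκ0.ne']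
    have h6 : κ ^ 4 ≤ κ ^ 2 := by nlinarith [sq_nonneg κ, sq_nonneg (κ ^ 2)]
    linarith [sq_nonneg (X - κ)]
  have hfin := average_fderiv_radial hw
  have hd : Ψ 1 / κ ≤ 2 * κ * Z * Real.exp C := by
    rw [div_le_iff₀ hκ0]; linarith
  have hCΨ : C * Ψ 1 ≤ 2 * C * Real.exp C * κ * Z := by
    have h1 := mul_le_mul_of_nonneg_left hΨ1 (by linarith : 0 ≤ C)
    have h2 : κ ^ 2 ≤ κ := by nlinarith
    have h3 := mul_le_mul_of_nonneg_right h2 (by positivity : 0 ≤ 2 * C * Real.exp C * Z)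
    linarith
  have hk : κ ^ 2 ≤ 1 / 4 := by nlinarith
  have h9 := mul_le_mul_of_nonneg_right hk hP.le
  have h10 : κ * Z * S = κ * Z + 2 * κ * Z * Real.exp C + 2 * C * Real.exp C * κ * Z := by
    rw [hSdef]; ring
  linarith

end Rigidity

section Normalized

variable {n : ℕ}

lemma hasFDerivAt_scale {u : Euc n → ℝ} (hu : ContDiff ℝ 2 u) (μ l : ℝ) (y x : Euc n) :
    HasFDerivAt (fun x => μ * u (y + l • x)) ((μ * l) • fderiv ℝ u (y + l • x)) x := by
  have h1 : HasFDerivAt (fun x : Euc n => y + l • x) (l • ContinuousLinearMap.id ℝ (Euc n)) x :=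
    ((hasFDerivAt_id x).const_smul l).const_add y
  have h2 := (((hu.differentiable (by norm_num) (y + l • x)).hasFDerivAt).comp x h1).const_mul μ
  refine h2.congr_fderiv ?_
  ext v
  simp [mul_assoc]

lemma contDiff_scale {u : Euc n → ℝ} (hu : ContDiff ℝ 2 u) (μ l : ℝ) (y : Euc n) :
    ContDiff ℝ 2 fun x => μ * u (y + l • x) :=
  contDiff_const.mul (hu.comp (by fun_prop))

lemma elaplacian_scale {u : Euc n → ℝ} (hu : ContDiff ℝ 2 u) (μ l : ℝ) (y x : Euc n) :
    elaplacian (fun x => μ * u (y + l • x)) x = μ * l ^ 2 * elaplacian u (y + l • x) := by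
  unfold elaplacian
  rw [Finset.mul_sum]
  refine Finset.sum_congr rfl fun i _ => ?_
  set e : Euc n := EuclideanSpace.single i 1
  have h1 : (fun z => fderiv ℝ (fun x => μ * u (y + l • x)) z e) =
      fun z => (μ * l) * fderiv ℝ u (y + l • z) e := by
    ext z; rw [(hasFDerivAt_scale hu μ l y z).fderiv]; simp
  have h2 : HasFDerivAt (fun x : Euc n => y + l • x) (l • ContinuousLinearMap.id ℝ (Euc n)) x :=
    ((hasFDerivAt_id x).const_smul l).const_add y
  have h3 := ((((hu.fderiv_apply_one e).differentiable one_ne_zero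
    (y + l • x)).hasFDerivAt).comp x h2).const_mul (μ * l)
  rw [h1]
  refine (DFunLike.congr_fun h3.fderiv e).trans ?_
  simp
  ring

/-- A positive solution of `Δw + |∇w|^q w^p = 0` on the ball of radius `R`, for which
`w^(a-1) |∇w|` equals `1` at the centre and has controlled growth. -/
structure IsNormalized (p q a γ R : ℝ) (w : Euc n → ℝ) : Prop where
  contDiff : ContDiff ℝ 2 w
  pos : ∀ x ∈ Metric.ball (0 : Euc n) R, 0 < w x
  eq : ∀ x ∈ Metric.ball (0 : Euc n) R, elaplacian w x = -(‖fderiv ℝ w x‖ ^ q * w x ^ p)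
  center : w 0 ^ (a - 1) * ‖fderiv ℝ w 0‖ = 1
  le : ∀ x ∈ Metric.ball (0 : Euc n) R,
    w x ^ (a - 1) * ‖fderiv ℝ w x‖ ≤ (1 - ‖x‖ / R) ^ (-γ)

variable {p q a γ R : ℝ} {w : Euc n → ℝ}

lemma IsNormalized.le_of_norm_le (h : IsNormalized p q a γ R w) (hγ : 0 ≤ γ) {t : ℝ}
    (hR : 0 < R) (ht : t < 1) {x : Euc n} (hx : ‖x‖ ≤ t * R) :
    w x ^ (a - 1) * ‖fderiv ℝ w x‖ ≤ (1 - t) ^ (-γ) := by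
  have hxR : x ∈ Metric.ball (0 : Euc n) R := by
    rw [mem_ball_zero_iff]; nlinarith
  refine (h.le x hxR).trans (Real.rpow_le_rpow_of_nonpos (by linarith) ?_ (by linarith))
  have := (div_le_iff₀ hR).2 hx
  linarith

lemma IsNormalized.le_two_rpow (h : IsNormalized p q a γ R w) (hγ : 0 ≤ γ) (hR : 0 < R)
    {x : Euc n} (hx : x ∈ Metric.ball (0 : Euc n) (R / 2)) :
    w x ^ (a - 1) * ‖fderiv ℝ w x‖ ≤ 2 ^ γ := by
  have := h.le_of_norm_le hγ hR (t := 1 / 2) (by norm_num)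
    (x := x) (by rw [mem_ball_zero_iff] at hx; linarith)
  refine this.trans_eq ?_
  rw [Real.rpow_neg (by norm_num), ← Real.inv_rpow (by norm_num)]
  norm_num

lemma abs_rpow_sub_rpow_le (hu : ContDiff ℝ 2 w) (ha : 0 < a) {r K : ℝ}
    (hpos : ∀ x ∈ Metric.ball (0 : Euc n) r, 0 < w x)
    (hK : ∀ x ∈ Metric.ball (0 : Euc n) r, w x ^ (a - 1) * ‖fderiv ℝ w x‖ ≤ K)
    {x y : Euc n} (hx : x ∈ Metric.ball (0 : Euc n) r) (hy : y ∈ Metric.ball (0 : Euc n) r) :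
    |w y ^ a - w x ^ a| ≤ a * K * ‖y - x‖ := by
  refine (convex_ball (0 : Euc n) r).norm_image_sub_le_of_norm_hasFDerivWithin_le
    (𝕜 := ℝ) (f := fun z => w z ^ a) (f' := fun z => (a * w z ^ (a - 1)) • fderiv ℝ w z)
    (fun z hz => ?_) (fun z hz => ?_) hx hy
  · exact ((hu.differentiable (by norm_num) z).hasFDerivAt.rpow_const
      (Or.inl (hpos z hz).ne')).hasFDerivWithinAt
  · rw [norm_smul, Real.norm_of_nonneg (by have := hpos z hz; positivity), mul_assoc]
    exact mul_le_mul_of_nonneg_left (hK z hz) ha.le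

/-- `|∇w|` in terms of the normalized gradient. -/
lemma norm_fderiv_eq_rpow_mul {x : Euc n} (hx : 0 < w x) :
    ‖fderiv ℝ w x‖ = w x ^ (1 - a) * (w x ^ (a - 1) * ‖fderiv ℝ w x‖) := by
  rw [← mul_assoc, ← Real.rpow_add hx]; simp

lemma IsNormalized.exists_lower_bound (n : ℕ) (ha : 0 < a) (hq : 0 < q) (hγ : 0 ≤ γ)
    (haq : a * q ≤ p + q - 1) :
    ∃ ε > 0, ∀ R ≥ 2, ∀ w : Euc n → ℝ, IsNormalized p q a γ R w → ε ≤ w 0 ^ a := by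
  set K : ℝ := 2 ^ γ with hK
  have hK0 : 0 < K := by positivity
  set τ : ℝ := 30 * 2 ^ n with hτ
  have hτ0 : 0 < τ := by positivity
  set e : ℝ := (p + q - a * q) / a with he
  have hea : 1 / a ≤ e := by rw [he]; gcongr; linarith
  have he0 : 0 < e := lt_of_lt_of_le (by positivity) hea
  set D : ℝ := 2 * τ * (K ^ q * (1 + a * K * τ) ^ e) with hD
  have hD0 : 0 < D := by positivity
  have hm : 0 < 2 + e - 1 / a := by linarith
  refine ⟨min (1 / (2 * τ)) (D⁻¹ ^ (2 + e - 1 / a)⁻¹), by positivity, fun R hR w h => ?_⟩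
  have hR0 : 0 < R := by linarith
  have hw0 : 0 < w 0 := h.pos 0 (Metric.mem_ball_self hR0)
  set ε := w 0 ^ a with hε
  have hε0 : 0 < ε := by positivity
  have hsubR : Metric.ball (0 : Euc n) 1 ⊆ Metric.ball 0 R := Metric.ball_subset_ball (by linarith)
  by_contra! hlt
  have h1 : ε < 1 / (2 * τ) := hlt.trans_le (min_le_left _ _)
  have h2 : ε < D⁻¹ ^ (2 + e - 1 / a)⁻¹ := hlt.trans_le (min_le_right _ _)
  rw [lt_div_iff₀ (by positivity)] at h1
  have hN : ∀ x ∈ Metric.ball (0 : Euc n) 1, w x ^ (a - 1) * ‖fderiv ℝ w x‖ ≤ K := fun x hx =>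
    h.le_two_rpow hγ hR0 (Metric.ball_subset_ball (by linarith) hx)
  have hsub1 : Metric.ball (0 : Euc n) (2 * (τ * ε)) ⊆ Metric.ball 0 1 :=
    Metric.ball_subset_ball (by linarith)
  have hlap : ∀ z ∈ Metric.ball (0 : Euc n) (τ * ε),
      |elaplacian w z| ≤ K ^ q * (ε * (1 + a * K * τ)) ^ e := fun z hz => by
    have hz1 : z ∈ Metric.ball (0 : Euc n) 1 :=
      hsub1 (Metric.ball_subset_ball (by nlinarith [mul_pos hτ0 hε0]) hz)
    have hwz := h.pos z (hsubR hz1)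
    have hv : w z ^ a ≤ ε * (1 + a * K * τ) := by
      have h3 := abs_rpow_sub_rpow_le h.contDiff ha (fun x hx => h.pos x (hsubR hx)) hN
        (Metric.mem_ball_self one_pos) hz1
      rw [mem_ball_zero_iff] at hz
      rw [sub_zero] at h3
      have h4 := mul_le_mul_of_nonneg_left hz.le (by positivity : 0 ≤ a * K)
      linarith [le_of_abs_le h3]
    rw [h.eq z (hsubR hz1), abs_neg, abs_of_nonneg (by positivity)]
    have e1 : ‖fderiv ℝ w z‖ ^ q * w z ^ p =
        (w z ^ (a - 1) * ‖fderiv ℝ w z‖) ^ q * (w z ^ a) ^ e := by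
      rw [Real.mul_rpow (by positivity) (by positivity), ← Real.rpow_mul hwz.le,
        ← Real.rpow_mul hwz.le, mul_right_comm, ← Real.rpow_add hwz, mul_comm (w z ^ _)]
      congr 2
      rw [he]; field_simp; ring
    rw [e1]
    gcongr
    exact hN z hz1
  have hgrad := norm_fderiv_le_of_superharmonic h.contDiff (x := 0) (T := τ * ε)
    (by positivity) (by positivity) (fun z hz => (h.pos z (hsubR (hsub1 hz))).le)
    (fun z hz => by
      have := h.pos z (hsubR (hsub1 hz))
      rw [h.eq z (hsubR (hsub1 hz))]
      exact neg_nonpos.2 (by positivity)) hlap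
  have hw0e : w 0 = ε ^ (1 / a) := by
    rw [hε, ← Real.rpow_mul hw0.le]; field_simp; simp
  have hDw : ‖fderiv ℝ w 0‖ = ε ^ (1 / a - 1) := by
    rw [norm_fderiv_eq_rpow_mul (a := a) hw0, h.center, mul_one, hw0e, ← Real.rpow_mul hε0.le]
    congr 1; field_simp
  have e2 : 15 * 2 ^ n * w 0 / (τ * ε) = 1 / 2 * ε ^ (1 / a - 1) := by
    rw [hw0e, Real.rpow_sub_one hε0.ne', hτ]; field_simp; norm_num
  have e3 : τ * ε * (K ^ q * (ε * (1 + a * K * τ)) ^ e) = D / 2 * ε ^ (1 + e) := by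
    rw [Real.mul_rpow hε0.le (by positivity), Real.rpow_add hε0, Real.rpow_one, hD]; ring
  rw [hDw, e2, e3] at hgrad
  have e4 : ε ^ (1 + e) = ε ^ (2 + e - 1 / a) * ε ^ (1 / a - 1) := by
    rw [← Real.rpow_add hε0]; congr 1; ring
  have hpe : 0 < ε ^ (1 / a - 1) := by positivity
  have h5 : 1 ≤ D * ε ^ (2 + e - 1 / a) := by
    rw [e4] at hgrad
    by_contra! hc
    nlinarith
  have h6 : ε ^ (2 + e - 1 / a) < D⁻¹ := by
    have := Real.rpow_lt_rpow hε0.le h2 hm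
    rwa [← Real.rpow_mul (inv_pos.2 hD0).le, inv_mul_cancel₀ hm.ne', Real.rpow_one] at this
  have h7 := mul_lt_mul_of_pos_left h6 hD0
  rw [mul_inv_cancel₀ hD0.ne'] at h7
  linarith

lemma IsNormalized.exists_upper_bound (n : ℕ) (ha : 0 < a) (hq : 0 < q) (hγ : 0 ≤ γ)
    (haq : a * q ≤ p + q - 1) :
    ∃ L R₁ : ℝ, 2 ≤ R₁ ∧ ∀ R ≥ R₁, ∀ w : Euc n → ℝ, IsNormalized p q a γ R w → w 0 ^ a ≤ L := by
  obtain ⟨δ, hδ, hno⟩ := exists_pos_no_almost_maximal_gradient n hq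
  set K : ℝ := 2 ^ γ with hK
  have hK0 : 0 < K := by positivity
  obtain ⟨δ', hδ'0, hδ'1, hδ'2, hδ'3⟩ : ∃ δ' > 0, δ' ≤ 1 ∧ 3 * δ' ≤ δ ∧ δ' * (1 + δ) ^ q ≤ δ := by
    refine ⟨min 1 (min (δ / 3) (δ / (1 + δ) ^ q)), by positivity, min_le_left _ _, ?_, ?_⟩
    · linarith [(min_le_right 1 (min (δ / 3) (δ / (1 + δ) ^ q))).trans (min_le_left _ _)]
    · rw [← le_div_iff₀ (by positivity)]
      exact (min_le_right _ _).trans (min_le_right _ _)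
  obtain ⟨η, hη0, hη⟩ : ∃ η > 0, ∀ σ : ℝ, |σ - 1| ≤ η →
      σ ^ ((1 - a) / a) ≤ 1 + δ' ∧ |1 - σ ^ (p / a)| ≤ δ' := by
    have h1 : ∀ᶠ σ : ℝ in 𝓝 1, σ ^ ((1 - a) / a) < 1 + δ' := by
      have := (Real.continuousAt_rpow_const 1 ((1 - a) / a) (Or.inl one_ne_zero)).tendsto
      rw [Real.one_rpow] at this
      exact this.eventually_lt_const (by linarith)
    have h2 : ∀ᶠ σ : ℝ in 𝓝 1, |1 - σ ^ (p / a)| < δ' := by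
      have := ((Real.continuousAt_rpow_const 1 (p / a) (Or.inl one_ne_zero)).tendsto.const_sub
        1).abs
      rw [Real.one_rpow, sub_self, abs_zero] at this
      exact this.eventually_lt_const hδ'0
    obtain ⟨r, hr, hr'⟩ := Metric.eventually_nhds_iff.1 (h1.and h2)
    refine ⟨r / 2, by positivity, fun σ hσ => ?_⟩
    have := hr' (y := σ) (by rw [Real.dist_eq]; linarith)
    exact ⟨this.1.le, this.2.le⟩
  obtain ⟨R₁, hR₁2, hR₁⟩ : ∃ R₁ : ℝ, 2 ≤ R₁ ∧ (1 - 1 / R₁) ^ (-γ) ≤ 1 + δ' := by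
    have h1 : Tendsto (fun R : ℝ => (1 - 1 / R) ^ (-γ)) atTop (𝓝 1) := by
      have h2 : Tendsto (fun R : ℝ => 1 - 1 / R) atTop (𝓝 1) := by
        simpa using (tendsto_const_nhds (x := (1 : ℝ))).sub tendsto_inv_atTop_zero
      have := (Real.continuousAt_rpow_const 1 (-γ) (Or.inl one_ne_zero)).tendsto.comp h2
      simpa [Function.comp_def] using this
    obtain ⟨R₁, h2, h3⟩ := ((h1.eventually_lt_const (by linarith : 1 < 1 + δ')).and
      (eventually_ge_atTop 2)).exists
    exact ⟨R₁, h3, h2.le⟩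
  refine ⟨max 1 (a * K / η), R₁, hR₁2, fun R hR w h => ?_⟩
  by_contra! hlt
  have hR2 : 2 ≤ R := hR₁2.trans hR
  have hR0 : 0 < R := by linarith
  have hw0 : 0 < w 0 := h.pos 0 (Metric.mem_ball_self hR0)
  set U := w 0 with hU
  have hUa1 : 1 ≤ U ^ a := (le_max_left _ _).trans hlt.le
  have hUa2 : a * K / U ^ a ≤ η := by
    rw [div_le_iff₀ (by positivity), ← div_le_iff₀' hη0]
    exact (le_max_right _ _).trans hlt.le
  have hU1 : 1 ≤ U := by
    by_contra! hc
    exact absurd hUa1 (not_le.2 (Real.rpow_lt_one hw0.le hc ha))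
  set e' : ℝ := (a - 1) * (1 - q) + p with he'
  have he'0 : 0 ≤ e' := by rw [he']; nlinarith
  set r : ℝ := U ^ (-e') with hr
  have hr0 : 0 < r := Real.rpow_pos_of_pos hw0 _
  have hr1 : r ≤ 1 := Real.rpow_le_one_of_one_le_of_nonpos hU1 (by linarith)
  set μ : ℝ := U ^ (a - 1 + e') with hμ
  have hμ0 : 0 < μ := Real.rpow_pos_of_pos hw0 _
  have hμr : μ * r = U ^ (a - 1) := by
    rw [hμ, hr, ← Real.rpow_add hw0]; congr 1; ring
  have hsubR : Metric.ball (0 : Euc n) 1 ⊆ Metric.ball 0 R := Metric.ball_subset_ball (by linarith)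
  have hN : ∀ x ∈ Metric.ball (0 : Euc n) 1, w x ^ (a - 1) * ‖fderiv ℝ w x‖ ≤ K := fun x hx =>
    h.le_two_rpow hγ hR0 (Metric.ball_subset_ball (by linarith) hx)
  have hmem : ∀ x ∈ Metric.ball (0 : Euc n) 1, r • x ∈ Metric.ball (0 : Euc n) 1 := fun x hx => by
    rw [mem_ball_zero_iff] at hx ⊢
    rw [norm_smul, Real.norm_of_nonneg hr0.le]
    nlinarith [norm_nonneg x]
  have hfd : ∀ x, fderiv ℝ (fun x => μ * w (0 + r • x)) x = (μ * r) • fderiv ℝ w (0 + r • x) :=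
    fun x => (hasFDerivAt_scale h.contDiff μ r 0 x).fderiv
  have hnorm : ∀ x ∈ Metric.ball (0 : Euc n) 1,
      ‖fderiv ℝ (fun x => μ * w (0 + r • x)) x‖ ≤ 1 + δ ∧
      |elaplacian (fun x => μ * w (0 + r • x)) x +
        ‖fderiv ℝ (fun x => μ * w (0 + r • x)) x‖ ^ q| ≤ δ := fun x hx => by
    rw [hfd, elaplacian_scale h.contDiff]
    have hm := hmem x hx
    rw [zero_add]
    set z := r • x with hz
    have hwz : 0 < w z := h.pos z (hsubR hm)
    set s : ℝ := w z / U with hs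
    have hs0 : 0 < s := by positivity
    have hwzs : w z = U * s := by rw [hs]; field_simp
    have hsa : |s ^ a - 1| ≤ η := by
      have h3 := abs_rpow_sub_rpow_le h.contDiff ha (fun x hx => h.pos x (hsubR hx)) hN
        (Metric.mem_ball_self one_pos) hm
      rw [sub_zero] at h3
      rw [mem_ball_zero_iff] at hm
      have e1 : s ^ a - 1 = (w z ^ a - U ^ a) / U ^ a := by
        rw [hs, Real.div_rpow hwz.le hw0.le]; field_simp
      rw [e1, abs_div, abs_of_pos (Real.rpow_pos_of_pos hw0 a)]
      refine le_trans ?_ hUa2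
      gcongr
      exact h3.trans (mul_le_of_le_one_right (by positivity) hm.le)
    obtain ⟨h4, h5⟩ := hη _ hsa
    rw [← Real.rpow_mul hs0.le, mul_div_cancel₀ _ ha.ne'] at h4 h5
    have hNz : w z ^ (a - 1) * ‖fderiv ℝ w z‖ ≤ 1 + δ' := by
      refine (h.le_of_norm_le hγ hR0 (t := 1 / R₁) ?_ ?_).trans hR₁
      · rw [div_lt_one (by linarith)]; linarith
      · rw [mem_ball_zero_iff] at hm
        have : 1 ≤ 1 / R₁ * R := by
          rw [one_div_mul_eq_div, one_le_div (by linarith)]; exact hR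
        linarith
    have hDu : ‖(μ * r) • fderiv ℝ w z‖ = s ^ (1 - a) * (w z ^ (a - 1) * ‖fderiv ℝ w z‖) := by
      rw [norm_smul, Real.norm_of_nonneg (by positivity), hμr]
      conv_lhs => rw [norm_fderiv_eq_rpow_mul (a := a) hwz]
      conv_lhs => enter [2, 1]; rw [hwzs, Real.mul_rpow hw0.le hs0.le]
      have e5 : U ^ (a - 1) * U ^ (1 - a) = 1 := by rw [← Real.rpow_add hw0]; simp
      linear_combination s ^ (1 - a) * w z ^ (a - 1) * ‖fderiv ℝ w z‖ * e5
    have hDu1 : ‖(μ * r) • fderiv ℝ w z‖ ≤ 1 + δ := by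
      rw [hDu]
      calc _ ≤ (1 + δ') * (1 + δ') := by gcongr
        _ ≤ 1 + δ := by nlinarith
    refine ⟨hDu1, ?_⟩
    have e2 : μ * r ^ 2 * elaplacian w z = -(s ^ p * ‖(μ * r) • fderiv ℝ w z‖ ^ q) := by
      rw [h.eq z (hsubR hm), norm_smul, Real.norm_of_nonneg (by positivity),
        Real.mul_rpow (by positivity) (norm_nonneg _), hwzs, Real.mul_rpow hw0.le hs0.le]
      have e3 : μ * r ^ 2 * U ^ p = (μ * r) ^ q := by
        rw [hμr, ← Real.rpow_mul hw0.le, pow_two, ← mul_assoc, hμr, hr, ← Real.rpow_add hw0,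
          ← Real.rpow_add hw0]
        congr 1; rw [he']; ring
      rw [← e3]; ring
    rw [e2]
    set X := ‖(μ * r) • fderiv ℝ w z‖ with hX
    have e4 : -(s ^ p * X ^ q) + X ^ q = (1 - s ^ p) * X ^ q := by ring
    rw [e4, abs_mul, abs_of_nonneg (by positivity : 0 ≤ X ^ q)]
    refine le_trans ?_ hδ'3
    gcongr
  refine hno (fun x => μ * w (0 + r • x)) (contDiff_scale h.contDiff μ r 0) ?_
    (fun x hx => (hnorm x hx).1) (fun x hx => (hnorm x hx).2)
  rw [hfd, smul_zero, zero_add, norm_smul, Real.norm_of_nonneg (by positivity), hμr]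
  exact h.center

end Normalized

lemma rpow_le_rpow_add_rpow {c C x : ℝ} (s : ℝ) (hc : 0 < c) (hcx : c ≤ x) (hxC : x ≤ C) :
    x ^ s ≤ c ^ s + C ^ s := by
  have hx : 0 < x := hc.trans_le hcx
  have hC : 0 < C := hx.trans_le hxC
  rcases le_total 0 s with hs | hs
  · have := Real.rpow_le_rpow hx.le hxC hs
    have := Real.rpow_pos_of_pos hc s
    linarith
  · have := Real.rpow_le_rpow_of_nonpos hc hcx hs
    have := Real.rpow_pos_of_pos hC s
    linarith

lemma exists_abs_rpow_sub_le_of_pos {c C : ℝ} (p : ℝ) (hc : 0 < c) (hcC : c ≤ C) :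
    ∃ L ≥ 0, ∀ x ∈ Icc c C, ∀ y ∈ Icc c C, |x ^ p - y ^ p| ≤ L * |x - y| := by
  refine ⟨|p| * (c ^ (p - 1) + C ^ (p - 1)), by have := hc.trans_le hcC; positivity,
    fun x hx y hy => ?_⟩
  refine (convex_Icc c C).norm_image_sub_le_of_norm_hasDerivWithin_le
    (f := fun z => z ^ p) (f' := fun z => p * z ^ (p - 1)) (fun z hz => ?_) (fun z hz => ?_) hy hx
  · exact (Real.hasDerivAt_rpow_const (Or.inl (hc.trans_le hz.1).ne')).hasDerivWithinAt
  · have hz0 : 0 < z := hc.trans_le hz.1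
    rw [norm_mul, Real.norm_eq_abs, Real.norm_of_nonneg (by positivity)]
    gcongr
    exact rpow_le_rpow_add_rpow _ hc hz.1 hz.2

lemma exists_abs_rpow_sub_le_rpow {q B : ℝ} (hq : 0 < q) (hB : 0 ≤ B) :
    ∃ L ≥ 0, ∀ x ∈ Icc 0 B, ∀ y ∈ Icc 0 B, |x ^ q - y ^ q| ≤ L * |x - y| ^ min q 1 := by
  rcases le_total q 1 with h | h
  · refine ⟨1, zero_le_one, fun x hx y hy => ?_⟩
    rw [min_eq_left h, one_mul]
    wlog hyx : y ≤ x generalizing x y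
    · rw [abs_sub_comm, abs_sub_comm x]
      exact this y hy x hx (le_of_not_ge hyx)
    have h1 := Real.rpow_le_rpow hy.1 hyx hq.le
    have h2 := Real.rpow_add_le_add_rpow hy.1 (sub_nonneg.2 hyx) hq.le h
    rw [add_sub_cancel] at h2
    rw [abs_of_nonneg (by linarith), abs_of_nonneg (by linarith)]
    linarith
  · refine ⟨q * B ^ (q - 1), by positivity, fun x hx y hy => ?_⟩
    rw [min_eq_right h, Real.rpow_one]
    refine (convex_Icc 0 B).norm_image_sub_le_of_norm_hasDerivWithin_le
      (f := fun z => z ^ q) (f' := fun z => q * z ^ (q - 1)) (fun z hz => ?_) (fun z hz => ?_)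
      hy hx
    · exact (Real.hasDerivAt_rpow_const (Or.inr h)).hasDerivWithinAt
    · rw [norm_mul, Real.norm_of_nonneg hq.le, Real.norm_of_nonneg (Real.rpow_nonneg hz.1 _)]
      exact mul_le_mul_of_nonneg_left (Real.rpow_le_rpow hz.1 hz.2 (by linarith)) hq.le

section LocalBounds

variable {n : ℕ}

/-- Second order estimates for solutions with two-sided bounds and bounded gradient. -/
lemma exists_second_order_bounds (n : ℕ) (p : ℝ) {q c C B : ℝ} (hq : 0 < q) (hc : 0 < c)
    (hcC : c ≤ C) (hB : 0 ≤ B) :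
    ∃ A θ : ℝ, 0 < θ ∧ ∀ ρ : ℝ, ∀ w : Euc n → ℝ, ContDiff ℝ 2 w →
      (∀ x ∈ Metric.ball (0 : Euc n) (ρ + 4), w x ∈ Icc c C ∧ ‖fderiv ℝ w x‖ ≤ B ∧
        elaplacian w x = -(‖fderiv ℝ w x‖ ^ q * w x ^ p)) →
      ∀ x ∈ Metric.ball (0 : Euc n) ρ, ‖fderiv ℝ (fderiv ℝ w) x‖ ≤ A ∧
        ∀ x' : Euc n, ‖x - x'‖ ≤ 1 →
          ‖fderiv ℝ (fderiv ℝ w) x - fderiv ℝ (fderiv ℝ w) x'‖ ≤ A * ‖x - x'‖ ^ θ := by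
  have hZ := kernelMass_pos (n := n)
  have hC : 0 < C := hc.trans_le hcC
  set V := volume.real (Metric.ball (0 : Euc n) 1) with hV'
  have hV : 0 ≤ V := measureReal_nonneg
  obtain ⟨Lp, hLp0, hLp⟩ := exists_abs_rpow_sub_le_of_pos p hc hcC
  obtain ⟨Lq, hLq0, hLq⟩ := exists_abs_rpow_sub_le_rpow hq hB
  set m : ℝ := min q 1 with hm
  have hm0 : 0 < m := lt_min hq one_pos
  have hm1 : m ≤ 1 := min_le_right _ _
  set M : ℝ := B ^ q * (c ^ p + C ^ p) with hM
  have hM0 : 0 ≤ M := by positivity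
  set A₁ : ℝ := 2 * M + 6 * B * V / kernelMass n with hA₁
  have hA₁0 : 0 ≤ A₁ := by positivity
  set H : ℝ := Lq * A₁ ^ m * (c ^ p + C ^ p) + B ^ q * (Lp * B) with hH
  have hH0 : 0 ≤ H := by positivity
  set α : ℝ := m / 2 with hα
  have hα0 : 0 < α := by positivity
  have hα1 : α ≤ 1 := by linarith
  set D₁ : ℝ := (7 * H / α + 6 * B) * V / kernelMass n with hD₁
  set D₂ : ℝ := (14 * H / α + 6 * A₁) * V / kernelMass n with hD₂
  refine ⟨max D₁ D₂, α / 4, by positivity, fun ρ w hw h x hx => ?_⟩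
  have hsub : ∀ {r s : ℝ} {z : Euc n}, z ∈ Metric.ball (0 : Euc n) r →
      Metric.ball z s ⊆ Metric.ball 0 (r + s) := fun {r s z} hz => by
    refine Metric.ball_subset_ball' ?_
    linarith [Metric.mem_ball.1 hz]
  have hlap : ∀ z ∈ Metric.ball (0 : Euc n) (ρ + 4), |elaplacian w z| ≤ M := fun z hz => by
    obtain ⟨h1, h2, h3⟩ := h z hz
    have hwz : 0 < w z := hc.trans_le h1.1
    rw [h3, abs_neg, abs_of_nonneg (by positivity)]
    exact mul_le_mul (Real.rpow_le_rpow (norm_nonneg _) h2 hq.le)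
      (rpow_le_rpow_add_rpow p hc h1.1 h1.2) (by positivity) (by positivity)
  have hgrad : ∀ z ∈ Metric.ball (0 : Euc n) (ρ + 2), ∀ z' : Euc n, ‖z - z'‖ ≤ 1 →
      ‖fderiv ℝ w z - fderiv ℝ w z'‖ ≤ A₁ * √‖z - z'‖ := fun z hz z' hzz => by
    have hs : Metric.ball z 2 ⊆ Metric.ball 0 (ρ + 4) :=
      (hsub hz).trans (Metric.ball_subset_ball (by linarith))
    exact norm_fderiv_sub_le hw hzz (fun y hy => (h y (hs hy)).2.1) (fun y hy => hlap y (hs hy))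
  have hf : ∀ z ∈ Metric.ball (0 : Euc n) (ρ + 2), ∀ z' : Euc n, ‖z - z'‖ ≤ 1 →
      |elaplacian w z - elaplacian w z'| ≤ H * ‖z - z'‖ ^ α := fun z hz z' hzz => by
    have hz4 : z ∈ Metric.ball (0 : Euc n) (ρ + 4) := Metric.ball_subset_ball (by linarith) hz
    have hz'4 : z' ∈ Metric.ball (0 : Euc n) (ρ + 4) := by
      refine Metric.ball_subset_ball (by linarith) (hsub hz (?_ : z' ∈ Metric.ball z 2))
      rw [Metric.mem_ball, dist_comm, dist_eq_norm]; linarith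
    have hg := hgrad z hz z' hzz
    obtain ⟨h1, h2, h3⟩ := h z hz4
    obtain ⟨h1', h2', h3'⟩ := h z' hz'4
    have hwz : 0 < w z := hc.trans_le h1.1
    set s := ‖z - z'‖ with hs
    have hs0 : 0 ≤ s := norm_nonneg _
    have hwd : |w z - w z'| ≤ B * s :=
      (convex_ball (0 : Euc n) (ρ + 4)).norm_image_sub_le_of_norm_fderiv_le (𝕜 := ℝ) (f := w)
        (fun y _ => hw.differentiable (by norm_num) y) (fun y hy => (h y hy).2.1) hz'4 hz4
    have hsα : s ≤ s ^ α := by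
      rcases hs0.eq_or_lt with h0 | h0
      · rw [← h0, Real.zero_rpow hα0.ne']
      · simpa using Real.rpow_le_rpow_of_exponent_ge h0 hzz hα1
    have e1 : |‖fderiv ℝ w z‖ ^ q - ‖fderiv ℝ w z'‖ ^ q| ≤ Lq * A₁ ^ m * s ^ α := by
      refine (hLq _ ⟨norm_nonneg _, h2⟩ _ ⟨norm_nonneg _, h2'⟩).trans ?_
      have e2 : (A₁ * √s) ^ m = A₁ ^ m * s ^ α := by
        rw [Real.mul_rpow hA₁0 (Real.sqrt_nonneg _), Real.sqrt_eq_rpow, ← Real.rpow_mul hs0]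
        congr 2; rw [hα]; ring
      rw [mul_assoc, ← e2]
      gcongr
      exact (abs_norm_sub_norm_le _ _).trans hg
    have e3 : |w z ^ p - w z' ^ p| ≤ Lp * B * s ^ α := by
      refine (hLp _ h1 _ h1').trans ?_
      rw [mul_assoc]
      gcongr
      exact hwd.trans (mul_le_mul_of_nonneg_left hsα hB)
    have e4 : elaplacian w z - elaplacian w z' =
        -((‖fderiv ℝ w z‖ ^ q - ‖fderiv ℝ w z'‖ ^ q) * w z ^ p +
          ‖fderiv ℝ w z'‖ ^ q * (w z ^ p - w z' ^ p)) := by rw [h3, h3']; ring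
    rw [e4, abs_neg]
    refine (abs_add_le _ _).trans ?_
    rw [abs_mul, abs_mul, abs_of_nonneg (by positivity : 0 ≤ w z ^ p),
      abs_of_nonneg (by positivity : 0 ≤ ‖fderiv ℝ w z'‖ ^ q)]
    calc _ ≤ Lq * A₁ ^ m * s ^ α * (c ^ p + C ^ p) + B ^ q * (Lp * B * s ^ α) := by
          have := rpow_le_rpow_add_rpow p hc h1.1 h1.2
          gcongr
      _ = H * s ^ α := by rw [hH]; ring
  have hx2 : Metric.ball x 2 ⊆ Metric.ball 0 (ρ + 2) := hsub hx
  have hx1 : Metric.ball x 1 ⊆ Metric.ball x 2 := Metric.ball_subset_ball (by norm_num)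
  constructor
  · refine (norm_fderiv_fderiv_le hw hH0 hα0 (K := B) (fun z hz => ?_) (fun z hz => ?_)).trans
      (le_max_left _ _)
    · exact (h z (Metric.ball_subset_ball (by linarith) (hx2 (hx1 hz)))).2.1
    · refine hf z (hx2 (hx1 hz)) x ?_
      rw [← dist_eq_norm]; exact (Metric.mem_ball.1 hz).le
  · intro x' hxx
    refine (norm_fderiv_fderiv_sub_le hw hxx hA₁0 hH0 hα0 hα1
      (fun z hz z' _ => hgrad z (hx2 hz) z') (fun z hz z' _ => hf z (hx2 hz) z')).trans ?_
    gcongr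
    exact le_max_right _ _

lemma le_of_superharmonic_of_le_on_ball {w : Euc n → ℝ} (hw : ContDiff ℝ 2 w) {x : Euc n}
    {T r m : ℝ} (hr : 0 < r) (hm : 0 ≤ m) (hxr : ‖x‖ + r ≤ T / 2)
    (hsup : ∀ z ∈ Metric.ball x T, elaplacian w z ≤ 0) (hpos : ∀ z ∈ Metric.ball x T, 0 ≤ w z)
    (hle : ∀ z ∈ Metric.ball (0 : Euc n) r, m ≤ w z) :
    m * (3 / 4) ^ 3 * volume.real (Metric.ball (0 : Euc n) (r / T)) / kernelMass n ≤ w x := by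
  have hZ := kernelMass_pos (n := n)
  have hT : 0 < T := by linarith [norm_nonneg x]
  rw [div_le_iff₀ hZ]
  refine le_trans ?_ (average_le_of_superharmonic hw hT.le hsup)
  have hρ : IsBallKernel (ballKernel 3 : Euc n → ℝ) := isBallKernel_ballKernel (by norm_num)
  have hint := hρ.integrable_mul (F := fun y => w (x - T • y)) (hw.continuous.comp (by fun_prop))
  set S := Metric.ball (T⁻¹ • x) (r / T) with hS
  have hSv : volume.real (Metric.ball (0 : Euc n) (r / T)) = volume.real S :=
    (Measure.addHaar_real_ball_center volume (T⁻¹ • x) (r / T)).symm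
  rw [hSv]
  have h1 : ∫ y in S, w (x - T • y) * ballKernel 3 y ≤ ∫ y, w (x - T • y) * ballKernel 3 y := by
    refine setIntegral_le_integral hint (Eventually.of_forall fun y => ?_)
    rcases lt_or_ge ‖y‖ 1 with hy | hy
    · exact mul_nonneg (hpos _ (sub_smul_mem_ball hT le_rfl hy)) (ballKernel_nonneg 3 y)
    · simp [hρ.eq_zero y hy]
  refine le_trans ?_ h1
  have h2 : ∫ y in S, m * (3 / 4) ^ 3 = m * (3 / 4) ^ 3 * volume.real S := by
    rw [setIntegral_const, smul_eq_mul, mul_comm]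
  rw [← h2]
  refine setIntegral_mono_on (integrableOn_const measure_ball_lt_top.ne) hint.integrableOn
    measurableSet_ball fun y hy => ?_
  have hyx : ‖x - T • y‖ < r := by
    rw [hS, Metric.mem_ball, dist_comm, dist_eq_norm, lt_div_iff₀ hT] at hy
    have : x - T • y = T • (T⁻¹ • x - y) := by rw [smul_sub, smul_inv_smul₀ hT.ne']
    rw [this, norm_smul, Real.norm_of_nonneg hT.le]
    linarith
  have hy2 : ‖y‖ ≤ 1 / 2 := by
    have h3 : ‖T • y‖ ≤ ‖x‖ + r := by
      have := norm_sub_norm_le (T • y) x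
      rw [norm_sub_rev] at this
      linarith
    rw [norm_smul, Real.norm_of_nonneg hT.le] at h3
    have : T * ‖y‖ ≤ T * (1 / 2) := by linarith
    exact le_of_mul_le_mul_left this hT
  have h4 := hle _ (mem_ball_zero_iff.2 hyx)
  have h5 := ballKernel_ge (k := 3) hy2
  exact mul_le_mul h4 h5 (by positivity) (hm.trans h4)

variable {p q a γ R : ℝ} {w : Euc n → ℝ}

lemma IsNormalized.exists_local_bounds (n : ℕ) (p q : ℝ) (ha : 0 < a) (hγ : 0 ≤ γ) {ε L ρ : ℝ}
    (hε : 0 < ε) (hεL : ε ≤ L) (hρ : 0 < ρ) :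
    ∃ c C B R₂ : ℝ, 0 < c ∧ c ≤ C ∧ 0 ≤ B ∧ ∀ R ≥ R₂, ∀ w : Euc n → ℝ,
      IsNormalized p q a γ R w → ε ≤ w 0 ^ a → w 0 ^ a ≤ L →
      ∀ x ∈ Metric.ball (0 : Euc n) ρ, w x ∈ Icc c C ∧ ‖fderiv ℝ w x‖ ≤ B ∧
        elaplacian w x = -(‖fderiv ℝ w x‖ ^ q * w x ^ p) := by
  have hL : 0 < L := hε.trans_le hεL
  have hZ := kernelMass_pos (n := n)
  set K : ℝ := 2 ^ γ with hK
  have hK0 : 0 < K := by positivity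
  set r : ℝ := ε / (2 * (a * K)) with hr
  have hr0 : 0 < r := by positivity
  set T : ℝ := 2 * (ρ + r) with hT
  have hT0 : 0 < T := by positivity
  set m : ℝ := (ε / 2) ^ (1 / a) with hm
  have hm0 : 0 < m := by positivity
  have hV : 0 < volume.real (Metric.ball (0 : Euc n) (r / T)) := by
    rw [measureReal_def]
    exact ENNReal.toReal_pos (Metric.measure_ball_pos volume _ (by positivity)).ne'
      measure_ball_lt_top.ne
  set c₀ : ℝ := m * (3 / 4) ^ 3 * volume.real (Metric.ball (0 : Euc n) (r / T)) / kernelMass n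
    with hc₀
  have hc₀0 : 0 < c₀ := by positivity
  set C₀ : ℝ := (L + a * K * ρ) ^ (1 / a) with hC₀
  have hC₀0 : 0 < C₀ := by positivity
  set c := min c₀ C₀ with hc
  have hc0 : 0 < c := lt_min hc₀0 hC₀0
  have hcC : c ≤ C₀ := min_le_right _ _
  refine ⟨c, C₀, (c ^ (1 - a) + C₀ ^ (1 - a)) * K, 2 * (ρ + r + T), hc0, hcC,
    by positivity, fun R hR w h h1 h2 x hx => ?_⟩
  have hR0 : 0 < R := by linarith
  have hsubR : Metric.ball (0 : Euc n) (R / 2) ⊆ Metric.ball 0 R :=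
    Metric.ball_subset_ball (by linarith)
  have hv : ∀ z ∈ Metric.ball (0 : Euc n) (R / 2), |w z ^ a - w 0 ^ a| ≤ a * K * ‖z‖ :=
    fun z hz => by
      simpa using abs_rpow_sub_rpow_le h.contDiff ha (fun x hx => h.pos x (hsubR hx))
        (fun x hx => h.le_two_rpow hγ hR0 hx) (Metric.mem_ball_self (by linarith)) hz
  have hρR : Metric.ball (0 : Euc n) ρ ⊆ Metric.ball 0 (R / 2) :=
    Metric.ball_subset_ball (by linarith)
  have hxR := hρR hx
  have hwx := h.pos x (hsubR hxR)
  have hxn : ‖x‖ < ρ := mem_ball_zero_iff.1 hx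
  have hup : w x ≤ C₀ := by
    have h3 : w x ^ a ≤ L + a * K * ρ := by
      have := le_of_abs_le (hv x hxR)
      have := mul_le_mul_of_nonneg_left hxn.le (by positivity : 0 ≤ a * K)
      linarith
    have h4 := Real.rpow_le_rpow (by positivity) h3 (by positivity : 0 ≤ 1 / a)
    rwa [← Real.rpow_mul hwx.le, mul_one_div_cancel ha.ne', Real.rpow_one] at h4
  have hxT : Metric.ball x T ⊆ Metric.ball 0 (R / 2) := by
    refine Metric.ball_subset_ball' ?_
    rw [dist_zero_right]; linarith
  have hlow : c ≤ w x := by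
    refine (min_le_left _ _).trans (le_of_superharmonic_of_le_on_ball h.contDiff hr0 hm0.le
      (by linarith) (fun z hz => ?_) (fun z hz => (h.pos z (hsubR (hxT hz))).le) fun z hz => ?_)
    · have := h.pos z (hsubR (hxT hz))
      rw [h.eq z (hsubR (hxT hz))]
      exact neg_nonpos.2 (by positivity)
    · have hzR : z ∈ Metric.ball (0 : Euc n) (R / 2) := Metric.ball_subset_ball (by linarith) hz
      have hwz := h.pos z (hsubR hzR)
      have h3 : ε / 2 ≤ w z ^ a := by
        have h4 := neg_le_of_abs_le (hv z hzR)
        have h5 := mul_le_mul_of_nonneg_left (mem_ball_zero_iff.1 hz).le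
          (by positivity : 0 ≤ a * K)
        have h6 : a * K * r = ε / 2 := by rw [hr]; field_simp
        linarith
      have h4 := Real.rpow_le_rpow (by positivity) h3 (by positivity : 0 ≤ 1 / a)
      rwa [← Real.rpow_mul hwz.le, mul_one_div_cancel ha.ne', Real.rpow_one] at h4
  refine ⟨⟨hlow, hup⟩, ?_, h.eq x (hsubR hxR)⟩
  rw [norm_fderiv_eq_rpow_mul (a := a) hwx]
  exact mul_le_mul (rpow_le_rpow_add_rpow _ hc0 hlow hup) (h.le_two_rpow hγ hR0 hxR)
    (by positivity) (by positivity)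

end LocalBounds

lemma Ultrafilter.exists_tendsto_of_eventually_norm_le {G : Type*} [NormedAddCommGroup G]
    [ProperSpace G] {ι : Type*} (𝒰 : Ultrafilter ι) {f : ι → G} {M : ℝ}
    (h : ∀ᶠ k in (𝒰 : Filter ι), ‖f k‖ ≤ M) : ∃ x, Tendsto f 𝒰 (𝓝 x) := by
  obtain ⟨x, -, hx⟩ := (isCompact_closedBall (0 : G) M).ultrafilter_le_nhds (𝒰.map f) <| by
    rw [le_principal_iff]
    exact h.mono fun k hk => mem_closedBall_zero_iff.2 hk
  exact ⟨x, hx⟩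

lemma Filter.Tendsto.clm_apply_const {X G : Type*} [NormedAddCommGroup X] [NormedSpace ℝ X]
    [NormedAddCommGroup G] [NormedSpace ℝ G] {ι : Type*} {l : Filter ι} {f : ι → X →L[ℝ] G}
    {F : X →L[ℝ] G} (h : Tendsto f l (𝓝 F)) (x : X) : Tendsto (fun k => f k x) l (𝓝 (F x)) :=
  ((ContinuousLinearMap.apply ℝ G x).continuous.tendsto F).comp h

lemma hasFDerivAt_of_tendsto_of_holder {X G : Type*} [NormedAddCommGroup X] [NormedSpace ℝ X]
    [NormedAddCommGroup G] [NormedSpace ℝ G] {ι : Type*} {l : Filter ι} [l.NeBot]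
    {f : ι → X → G} {F : X → G} {F' : X →L[ℝ] G} {x : X} {A θ : ℝ} (hθ : 0 < θ)
    (hf : ∀ k, Differentiable ℝ (f k)) (hF : ∀ y, Tendsto (fun k => f k y) l (𝓝 (F y)))
    (hF' : Tendsto (fun k => fderiv ℝ (f k) x) l (𝓝 F'))
    (hA : ∀ᶠ k in l, ∀ y, ‖x - y‖ ≤ 1 →
      ‖fderiv ℝ (f k) x - fderiv ℝ (f k) y‖ ≤ A * ‖x - y‖ ^ θ) :
    HasFDerivAt F F' x := by
  have key : ∀ y, ‖y - x‖ ≤ 1 → ‖F y - F x - F' (y - x)‖ ≤ A * ‖y - x‖ ^ θ * ‖y - x‖ := by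
    intro y hy
    have hlim : Tendsto (fun k => ‖f k y - f k x - fderiv ℝ (f k) x (y - x)‖) l
        (𝓝 ‖F y - F x - F' (y - x)‖) :=
      (((hF y).sub (hF x)).sub (hF'.clm_apply_const (y - x))).norm
    refine le_of_tendsto hlim (hA.mono fun k hk => ?_)
    have hA0 : 0 ≤ A * ‖y - x‖ ^ θ := by
      have := hk y (by rwa [norm_sub_rev])
      rw [norm_sub_rev x y] at this
      exact (norm_nonneg _).trans this
    refine (convex_closedBall x ‖y - x‖).norm_image_sub_le_of_norm_hasFDerivWithin_le'
      (f' := fun z => fderiv ℝ (f k) z)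
      (fun z _ => ((hf k) z).hasFDerivAt.hasFDerivWithinAt) (fun z hz => ?_)
      (Metric.mem_closedBall_self (norm_nonneg _)) (by simp [dist_eq_norm])
    rw [Metric.mem_closedBall, dist_eq_norm, norm_sub_rev] at hz
    have h1 := hk z (hz.trans hy)
    rw [norm_sub_rev]
    rcases eq_or_ne y x with rfl | hyx
    · have : z = y := by simpa [sub_eq_zero, eq_comm] using hz
      simpa [this] using hA0
    have hA1 : 0 ≤ A := by
      have : 0 < ‖y - x‖ ^ θ := Real.rpow_pos_of_pos (norm_pos_iff.2 (sub_ne_zero.2 hyx)) _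
      exact nonneg_of_mul_nonneg_left hA0 this
    exact h1.trans (by gcongr)
  rw [hasFDerivAt_iff_isLittleO]
  have hlim : Tendsto (fun y => A * ‖y - x‖ ^ θ) (𝓝 x) (𝓝 0) := by
    have h1 : Tendsto (fun y : X => ‖y - x‖) (𝓝 x) (𝓝 0) := by
      have : Continuous fun y : X => ‖y - x‖ := by fun_prop
      simpa using this.tendsto x
    have h2 := (h1.rpow_const (Or.inr hθ.le)).const_mul A
    simpa [Real.zero_rpow hθ.ne'] using h2
  rw [Asymptotics.isLittleO_iff]
  intro c hc
  have hball : ∀ᶠ y in 𝓝 x, ‖y - x‖ ≤ 1 := by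
    filter_upwards [Metric.closedBall_mem_nhds x one_pos] with y hy
    rwa [← dist_eq_norm]
  filter_upwards [hball, hlim.eventually (eventually_le_nhds hc)] with y hy hcy
  exact (key y hy).trans (by gcongr)

section Blowup

variable {n : ℕ} {p q a γ : ℝ}

lemma continuous_of_locally_holder {X G : Type*} [NormedAddCommGroup X] [NormedAddCommGroup G]
    {F : X → G} (h : ∀ x, ∃ A θ : ℝ, 0 < θ ∧ ∀ y, ‖x - y‖ ≤ 1 → ‖F x - F y‖ ≤ A * ‖x - y‖ ^ θ) :
    Continuous F := by
  rw [continuous_iff_continuousAt]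
  intro x
  obtain ⟨A, θ, hθ, hle⟩ := h x
  have hlim : Tendsto (fun y => A * ‖x - y‖ ^ θ) (𝓝 x) (𝓝 0) := by
    have h1 : Tendsto (fun y : X => ‖x - y‖) (𝓝 x) (𝓝 0) := by
      have : Continuous fun y : X => ‖x - y‖ := by fun_prop
      simpa using this.tendsto x
    simpa [Real.zero_rpow hθ.ne'] using (h1.rpow_const (Or.inr hθ.le)).const_mul A
  rw [ContinuousAt, tendsto_iff_norm_sub_tendsto_zero]
  refine squeeze_zero' (Eventually.of_forall fun _ => norm_nonneg _) ?_ hlim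
  filter_upwards [Metric.closedBall_mem_nhds x one_pos] with y hy
  rw [norm_sub_rev]
  exact hle y (by rwa [← dist_eq_norm, dist_comm])

lemma norm_fderiv_sub_le_of_second_order {w : Euc n → ℝ} (hw : ContDiff ℝ 2 w) {A : ℝ}
    {x y : Euc n} {ρ : ℝ} (hA : ∀ z ∈ Metric.ball (0 : Euc n) ρ, ‖fderiv ℝ (fderiv ℝ w) z‖ ≤ A)
    (hx : ‖x‖ < ρ) (hy : ‖y‖ < ρ) : ‖fderiv ℝ w x - fderiv ℝ w y‖ ≤ A * ‖x - y‖ :=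
  (convex_ball (0 : Euc n) ρ).norm_image_sub_le_of_norm_fderiv_le (f := fderiv ℝ w)
    (fun z _ => (hw.fderiv_right (m := 1) (by norm_num)).differentiable one_ne_zero z) hA
    (mem_ball_zero_iff.2 hy) (mem_ball_zero_iff.2 hx)

lemma norm_gradient (u : Euc n → ℝ) (x : Euc n) : ‖gradient u x‖ = ‖fderiv ℝ u x‖ := by
  simp [gradient]

/-- Limits of functions with locally uniform `C^{2,θ}` bounds are entire solutions. -/
lemma exists_entire_limit {q : ℝ} (p : ℝ) (hq : 0 < q) {w : ℕ → Euc n → ℝ}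
    (hw : ∀ k, ContDiff ℝ 2 (w k))
    (hb : ∀ ρ > 0, ∃ c C B A θ : ℝ, 0 < c ∧ 0 < θ ∧ ∀ᶠ k in atTop, ∀ x ∈ Metric.ball (0 : Euc n) ρ,
      w k x ∈ Icc c C ∧ ‖fderiv ℝ (w k) x‖ ≤ B ∧
      elaplacian (w k) x = -(‖fderiv ℝ (w k) x‖ ^ q * w k x ^ p) ∧
      ‖fderiv ℝ (fderiv ℝ (w k)) x‖ ≤ A ∧ ∀ x', ‖x - x'‖ ≤ 1 →
        ‖fderiv ℝ (fderiv ℝ (w k)) x - fderiv ℝ (fderiv ℝ (w k)) x'‖ ≤ A * ‖x - x'‖ ^ θ) :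
    ∃ W : Euc n → ℝ, ContDiff ℝ 2 W ∧ (∀ x, 0 < W x) ∧
      (∀ x, elaplacian W x = -(‖fderiv ℝ W x‖ ^ q * W x ^ p)) ∧
      ∃ 𝒰 : Ultrafilter ℕ, (𝒰 : Filter ℕ) ≤ atTop ∧ ∀ x, Tendsto (fun k => w k x) 𝒰 (𝓝 (W x)) ∧
        Tendsto (fun k => fderiv ℝ (w k) x) 𝒰 (𝓝 (fderiv ℝ W x)) := by
  set 𝒰 : Ultrafilter ℕ := Filter.hyperfilter ℕ
  have h𝒰 : (𝒰 : Filter ℕ) ≤ atTop := by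
    rw [← Nat.cofinite_eq_atTop]; exact hyperfilter_le_cofinite
  have hmem : ∀ x : Euc n, x ∈ Metric.ball (0 : Euc n) (‖x‖ + 1) := fun x => by simp
  have hpos : ∀ x : Euc n, 0 < ‖x‖ + 1 := fun x => by positivity
  have hex : ∀ x : Euc n, ∃ W : ℝ, ∃ D : Euc n →L[ℝ] ℝ, ∃ H : Euc n →L[ℝ] Euc n →L[ℝ] ℝ,
      0 < W ∧ Tendsto (fun k => w k x) 𝒰 (𝓝 W) ∧ Tendsto (fun k => fderiv ℝ (w k) x) 𝒰 (𝓝 D) ∧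
      Tendsto (fun k => fderiv ℝ (fderiv ℝ (w k)) x) 𝒰 (𝓝 H) := by
    intro x
    obtain ⟨c, C, B, A, θ, hc, -, h⟩ := hb _ (hpos x)
    have h := (h.filter_mono h𝒰).mono fun k hk => hk x (hmem x)
    obtain ⟨W, hW⟩ := 𝒰.exists_tendsto_of_eventually_norm_le (f := fun k => w k x) (M := C)
      (h.mono fun k hk => by
        rw [Real.norm_of_nonneg (hc.le.trans hk.1.1)]; exact hk.1.2)
    obtain ⟨D, hD⟩ := 𝒰.exists_tendsto_of_eventually_norm_le (h.mono fun k hk => hk.2.1)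
    obtain ⟨H, hH⟩ := 𝒰.exists_tendsto_of_eventually_norm_le
      (f := fun k => fderiv ℝ (fderiv ℝ (w k)) x) (M := A) (h.mono fun k hk => hk.2.2.2.1)
    exact ⟨W, D, H, hc.trans_le (ge_of_tendsto hW (h.mono fun k hk => hk.1.1)), hW, hD, hH⟩
  choose W D H hW0 hW hD hH using hex
  have hWD : ∀ x, HasFDerivAt W (D x) x := by
    intro x
    obtain ⟨c, C, B, A, θ, hc, -, h⟩ := hb (‖x‖ + 2) (by positivity)
    refine hasFDerivAt_of_tendsto_of_holder (A := A) one_pos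
      (fun k => (hw k).differentiable two_ne_zero) hW (hD x) ?_
    filter_upwards [h.filter_mono h𝒰] with k hk y hy
    rw [Real.rpow_one]
    refine norm_fderiv_sub_le_of_second_order (hw k) (fun z hz => (hk z hz).2.2.2.1)
      (by linarith) ?_
    have := norm_sub_norm_le y x
    rw [norm_sub_rev] at this
    linarith
  have hDH : ∀ x, HasFDerivAt D (H x) x := by
    intro x
    obtain ⟨c, C, B, A, θ, hc, hθ, h⟩ := hb _ (hpos x)
    refine hasFDerivAt_of_tendsto_of_holder (A := A) hθ
      (fun k => ((hw k).fderiv_right (m := 1) (by norm_num)).differentiable one_ne_zero) hD (hH x) ?_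
    filter_upwards [h.filter_mono h𝒰] with k hk
    exact (hk x (hmem x)).2.2.2.2
  have hfW : fderiv ℝ W = D := funext fun x => (hWD x).fderiv
  have hfD : fderiv ℝ D = H := funext fun x => (hDH x).fderiv
  have hHc : Continuous H := continuous_of_locally_holder (G := Euc n →L[ℝ] Euc n →L[ℝ] ℝ) fun x => by
    obtain ⟨c, C, B, A, θ, hc, hθ, h⟩ := hb _ (hpos x)
    exact ⟨A, θ, hθ, fun y hy =>
      le_of_tendsto (Filter.Tendsto.norm (E := Euc n →L[ℝ] Euc n →L[ℝ] ℝ) ((hH x).sub (hH y)))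
        ((h.filter_mono h𝒰).mono fun k hk => (hk x (hmem x)).2.2.2.2 y hy)⟩
  have hWc : ContDiff ℝ 2 W := by
    have hD1 : ContDiff ℝ 1 D :=
      contDiff_one_iff_fderiv.2 ⟨fun x => (hDH x).differentiableAt, hfD ▸ hHc⟩
    rw [show (2 : WithTop ℕ∞) = 1 + 1 by norm_num, contDiff_succ_iff_fderiv]
    exact ⟨fun x => (hWD x).differentiableAt, by simp, hfW ▸ hD1⟩
  refine ⟨W, hWc, hW0, fun x => ?_, 𝒰, h𝒰, fun x => ⟨hW x, hfW ▸ hD x⟩⟩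
  obtain ⟨c, C, B, A, θ, hc, hθ, h⟩ := hb _ (hpos x)
  have h1 : Tendsto (fun k => elaplacian (w k) x) 𝒰 (𝓝 (elaplacian W x)) := by
    simp_rw [elaplacian_eq (hw _), elaplacian_eq hWc, hfW, hfD]
    exact tendsto_finsetSum _ fun i _ =>
      ((hH x).clm_apply_const _).clm_apply_const _
  have h2 : Tendsto (fun k => -(‖fderiv ℝ (w k) x‖ ^ q * w k x ^ p)) 𝒰
      (𝓝 (-(‖fderiv ℝ W x‖ ^ q * W x ^ p))) := by
    rw [hfW]
    exact (((hD x).norm.rpow_const (Or.inr hq.le)).mul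
      ((hW x).rpow_const (Or.inl (hW0 x).ne'))).neg
  refine tendsto_nhds_unique h1 (h2.congr' ?_)
  filter_upwards [h.filter_mono h𝒰] with k hk
  exact (hk x (hmem x)).2.2.1.symm

/-- Under the Liouville property, normalized solutions live on balls of bounded radius. -/
theorem IsNormalized.exists_radius_bound (ha : 0 < a) (hq : 0 < q) (hγ : 0 ≤ γ)
    (haq : a * q ≤ p + q - 1)
    (hLiou : ∀ u : Euc n → ℝ, ContDiff ℝ 2 u → (∀ x, 0 < u x) →
      (∀ x, elaplacian u x + ‖gradient u x‖ ^ q * u x ^ p = 0) → ∀ x y, u x = u y) :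
    ∃ R₀ > 0, ∀ R ≥ R₀, ∀ w : Euc n → ℝ, ¬ IsNormalized p q a γ R w := by
  by_contra! hcon
  have hseq : ∀ k : ℕ, ∃ R : ℝ, (k : ℝ) + 1 ≤ R ∧ ∃ w : Euc n → ℝ, IsNormalized p q a γ R w :=
    fun k => hcon (k + 1) (by positivity)
  choose R hR w hw using hseq
  have hRev : ∀ r : ℝ, ∀ᶠ k in atTop, r ≤ R k := fun r => by
    obtain ⟨N, hN⟩ := exists_nat_ge r
    filter_upwards [eventually_ge_atTop N] with k hk
    have : (N : ℝ) ≤ k := by exact_mod_cast hk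
    linarith [hR k]
  obtain ⟨ε, hε, hlow⟩ := IsNormalized.exists_lower_bound n ha hq hγ haq
  obtain ⟨L₀, R₁, hR₁, hup⟩ := IsNormalized.exists_upper_bound n ha hq hγ haq
  obtain ⟨W, hWc, hW0, hWeq, 𝒰, h𝒰, hWlim⟩ := exists_entire_limit p hq (fun k => (hw k).contDiff)
    (fun ρ hρ => by
      obtain ⟨c, C, B, R₂, hc, hcC, hB, hloc⟩ := IsNormalized.exists_local_bounds n p q ha hγ hε
        (le_max_left ε L₀) (ρ := ρ + 4) (by positivity)
      obtain ⟨A, θ, hθ, hsec⟩ := exists_second_order_bounds n p hq hc hcC hB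
      refine ⟨c, C, B, A, θ, hc, hθ, ?_⟩
      filter_upwards [hRev 2, hRev R₁, hRev R₂] with k hk2 hk1 hkR x hx
      have h1 := hloc (R k) hkR (w k) (hw k) (hlow _ hk2 _ (hw k))
        ((hup _ hk1 _ (hw k)).trans (le_max_right _ _))
      have h2 := h1 x (Metric.ball_subset_ball (by linarith) hx)
      exact ⟨h2.1, h2.2.1, h2.2.2, hsec ρ (w k) (hw k).contDiff h1 x hx⟩)
  have hconst := hLiou W hWc hW0 fun x => by rw [hWeq, norm_gradient]; ring
  have hD0 : fderiv ℝ W 0 = 0 := by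
    rw [show W = fun _ => W 0 from funext fun x => hconst x 0]
    simp
  have h1 : Tendsto (fun k => w k 0 ^ (a - 1) * ‖fderiv ℝ (w k) 0‖) 𝒰
      (𝓝 (W 0 ^ (a - 1) * ‖fderiv ℝ W 0‖)) :=
    ((hWlim 0).1.rpow_const (Or.inl (hW0 0).ne')).mul (hWlim 0).2.norm
  simp only [(hw _).center, hD0, norm_zero, mul_zero] at h1
  exact one_ne_zero (tendsto_nhds_unique tendsto_const_nhds h1)

lemma ball_infDist_frontier_subset {Ω : Set (Euc n)} {x : Euc n} (hx : x ∈ Ω) :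
    Metric.ball x (Metric.infDist x (frontier Ω)) ⊆ Ω := by
  rcases (Metric.infDist_nonneg (x := x) (s := frontier Ω)).eq_or_lt with h0 | h0
  · simp [← h0]
  have hfr : ∀ z ∈ Metric.ball x (Metric.infDist x (frontier Ω)), z ∉ frontier Ω := fun z hz hf => by
    have := Metric.infDist_le_dist_of_mem (x := x) hf
    rw [Metric.mem_ball, dist_comm] at hz
    linarith
  refine ((convex_ball x _).isPreconnected.subset_left_of_subset_union isOpen_interior
    (isClosed_closure (s := Ω)).isOpen_compl ?_ ?_ ⟨x, Metric.mem_ball_self h0, ?_⟩).trans interior_subset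
  · exact disjoint_compl_right.mono_left interior_subset_closure
  · intro z hz
    by_contra h
    rw [mem_union, not_or, mem_compl_iff, not_not] at h
    exact hfr z hz ⟨h.2, h.1⟩
  · by_contra h
    exact hfr x (Metric.mem_ball_self h0) ⟨subset_closure hx, h⟩

lemma exists_contDiff_eventuallyEq {u : Euc n → ℝ} {x : Euc n} {r s : ℝ} (hr : 0 < r) (hrs : r < s)
    (hu : ContDiffOn ℝ 2 u (Metric.ball x s)) :
    ∃ v : Euc n → ℝ, ContDiff ℝ 2 v ∧ ∀ y ∈ Metric.closedBall x r, v =ᶠ[𝓝 y] u := by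
  let f : ContDiffBump x := ⟨(2 * r + s) / 3, (r + 2 * s) / 3, by linarith, by linarith⟩
  refine ⟨fun z => f z * u z, contDiff_iff_contDiffAt.2 fun z => ?_, fun y hy => ?_⟩
  · by_cases hz : z ∈ Metric.ball x s
    · exact f.contDiff.contDiffAt.mul (hu.contDiffAt (Metric.isOpen_ball.mem_nhds hz))
    · have hz' : z ∉ tsupport f := by
        rw [f.tsupport_eq]
        intro h
        rw [Metric.mem_closedBall] at h
        rw [Metric.mem_ball] at hz
        have : f.rOut = (r + 2 * s) / 3 := rfl
        linarith
      have h0 : (fun z => f z * u z) =ᶠ[𝓝 z] fun _ => 0 := by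
        filter_upwards [notMem_tsupport_iff_eventuallyEq.1 hz'] with y hy
        rw [hy]
        simp
      exact contDiffAt_const.congr_of_eventuallyEq h0
  · have hy' : y ∈ Metric.ball x f.rIn := by
      rw [Metric.mem_closedBall] at hy
      have : f.rIn = (2 * r + s) / 3 := rfl
      rw [Metric.mem_ball]
      linarith
    filter_upwards [f.eventuallyEq_one_of_mem_ball hy'] with z hz
    simp [hz]

lemma Filter.EventuallyEq.elaplacian_eq {u v : Euc n → ℝ} {x : Euc n} (h : u =ᶠ[𝓝 x] v) :
    elaplacian u x = elaplacian v x := by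
  refine Finset.sum_congr rfl fun i _ => ?_
  have : (fun y => fderiv ℝ u y (EuclideanSpace.single i 1)) =ᶠ[𝓝 x]
      fun y => fderiv ℝ v y (EuclideanSpace.single i 1) := by
    filter_upwards [h.fderiv (𝕜 := ℝ)] with y hy
    rw [hy]
  rw [this.fderiv_eq]

/-- Blow-up: a point where the weighted gradient is large yields a normalized solution. -/
lemma exists_isNormalized {u : Euc n → ℝ} (hu : ContDiff ℝ 2 u) {x₀ : Euc n} {d R₀ : ℝ}
    (hpq : 1 < p + q) (hγ : 0 < γ) (hγa : γ = 1 + a * ((2 - q) / (p + q - 1)))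
    (hd : 0 < d) (hR₀ : 0 < R₀) (hpos : ∀ x ∈ Metric.closedBall x₀ d, 0 < u x)
    (heq : ∀ x ∈ Metric.closedBall x₀ d, elaplacian u x = -(‖fderiv ℝ u x‖ ^ q * u x ^ p))
    (hlarge : R₀ ^ γ ≤ u x₀ ^ (a - 1) * ‖fderiv ℝ u x₀‖ * d ^ γ) :
    ∃ R ≥ R₀, ∃ w : Euc n → ℝ, IsNormalized p q a γ R w := by
  set β : ℝ := (2 - q) / (p + q - 1) with hβ
  have hβs : β * (p + q - 1) = 2 - q := div_mul_cancel₀ _ (by linarith)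
  set N : Euc n → ℝ := fun x => u x ^ (a - 1) * ‖fderiv ℝ u x‖ with hN
  have hNc : ContinuousOn (fun x => N x * (d - ‖x - x₀‖) ^ γ) (Metric.closedBall x₀ d) := by
    refine ContinuousOn.mul (ContinuousOn.mul ?_ ?_) ?_
    · exact hu.continuous.continuousOn.rpow_const fun x hx => Or.inl (hpos x hx).ne'
    · exact hu.fderiv_one.continuous.norm.continuousOn
    · exact (continuousOn_const.sub (by fun_prop)).rpow_const fun x _ => Or.inr hγ.le
  obtain ⟨y, hy, hmax⟩ := (isCompact_closedBall x₀ d).exists_isMaxOn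
    ⟨x₀, Metric.mem_closedBall_self hd.le⟩ hNc
  have hmax : ∀ x ∈ Metric.closedBall x₀ d,
      N x * (d - ‖x - x₀‖) ^ γ ≤ N y * (d - ‖y - x₀‖) ^ γ := fun x hx => hmax hx
  set D := d - ‖y - x₀‖ with hD
  have hyR : R₀ ^ γ ≤ N y * D ^ γ := by
    refine hlarge.trans ?_
    simpa [hN] using hmax x₀ (Metric.mem_closedBall_self hd.le)
  have hpos1 : 0 < N y * D ^ γ := (Real.rpow_pos_of_pos hR₀ γ).trans_le hyR
  have hD0 : 0 ≤ D := by
    rw [Metric.mem_closedBall, dist_eq_norm] at hy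
    linarith
  have hDpos : 0 < D := by
    refine hD0.lt_of_ne fun h => ?_
    rw [← h, Real.zero_rpow hγ.ne', mul_zero] at hpos1
    exact lt_irrefl _ hpos1
  have hNy : 0 < N y := pos_of_mul_pos_left hpos1 (by positivity)
  set l : ℝ := N y ^ (-γ⁻¹) with hl
  have hl0 : 0 < l := Real.rpow_pos_of_pos hNy _
  have hlγ : l ^ γ = (N y)⁻¹ := by
    rw [hl, ← Real.rpow_mul hNy.le, neg_mul, inv_mul_cancel₀ hγ.ne', Real.rpow_neg_one]
  have hR : R₀ ≤ D / l := by
    rw [← Real.rpow_le_rpow_iff hR₀.le (by positivity) hγ, Real.div_rpow hD0 hl0.le, hlγ,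
      div_inv_eq_mul, mul_comm]
    exact hyR
  have hRpos : 0 < D / l := by positivity
  have hin : ∀ x ∈ Metric.ball (0 : Euc n) (D / l),
      D * (1 - ‖x‖ / (D / l)) ≤ d - ‖y + l • x - x₀‖ ∧ 0 < 1 - ‖x‖ / (D / l) ∧
      y + l • x ∈ Metric.closedBall x₀ d := by
    intro x hx
    rw [mem_ball_zero_iff] at hx
    have h1 : 0 < 1 - ‖x‖ / (D / l) := by rw [sub_pos, div_lt_one hRpos]; exact hx
    have h2 : D * (1 - ‖x‖ / (D / l)) = D - l * ‖x‖ := by field_simp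
    have h3 : ‖y + l • x - x₀‖ ≤ ‖y - x₀‖ + l * ‖x‖ := by
      rw [add_sub_right_comm]
      refine (norm_add_le _ _).trans ?_
      rw [norm_smul, Real.norm_of_nonneg hl0.le]
    have h4 : D * (1 - ‖x‖ / (D / l)) ≤ d - ‖y + l • x - x₀‖ := by linarith
    refine ⟨h4, h1, ?_⟩
    rw [Metric.mem_closedBall, dist_eq_norm]
    have : 0 < D * (1 - ‖x‖ / (D / l)) := by positivity
    linarith
  have hfd : ∀ x, fderiv ℝ (fun x => l ^ β * u (y + l • x)) x =
      (l ^ β * l) • fderiv ℝ u (y + l • x) := fun x => (hasFDerivAt_scale hu _ l y x).fderiv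
  have hNorm : ∀ x, ‖fderiv ℝ (fun x => l ^ β * u (y + l • x)) x‖ =
      l ^ β * l * ‖fderiv ℝ u (y + l • x)‖ := fun x => by
    rw [hfd, norm_smul, Real.norm_of_nonneg (by positivity)]
  have hNw : ∀ x, 0 < u (y + l • x) →
      (l ^ β * u (y + l • x)) ^ (a - 1) * ‖fderiv ℝ (fun x => l ^ β * u (y + l • x)) x‖ =
      (N y)⁻¹ * N (y + l • x) := by
    intro x hx
    rw [hNorm, Real.mul_rpow (by positivity) hx.le, ← hlγ, ← Real.rpow_mul hl0.le]
    have : l ^ γ = l ^ (β * (a - 1)) * (l ^ β * l) := by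
      have h1 : l ^ β * l = l ^ (β + 1) := by rw [Real.rpow_add hl0, Real.rpow_one]
      rw [h1, ← Real.rpow_add hl0, hγa]
      congr 1
      ring
    rw [this]
    ring
  refine ⟨D / l, hR, fun x => l ^ β * u (y + l • x), contDiff_scale hu _ l y, fun x hx => ?_,
    fun x hx => ?_, ?_, fun x hx => ?_⟩
  · have := hpos _ (hin x hx).2.2
    positivity
  · have hup := hpos _ (hin x hx).2.2
    rw [elaplacian_scale hu, heq _ (hin x hx).2.2, hNorm,
      Real.mul_rpow (by positivity) (norm_nonneg _), Real.mul_rpow (by positivity) hup.le]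
    have : l ^ β * l ^ 2 = (l ^ β * l) ^ q * (l ^ β) ^ p := by
      have h1 : l ^ β * l = l ^ (β + 1) := by rw [Real.rpow_add hl0, Real.rpow_one]
      rw [h1, ← Real.rpow_mul hl0.le, ← Real.rpow_mul hl0.le, ← Real.rpow_natCast,
        ← Real.rpow_add hl0, ← Real.rpow_add hl0]
      congr 1
      push_cast
      linarith
    rw [this]
    ring
  · have := hNw 0 (by simpa using hpos y hy)
    rw [this]
    simp [hNy.ne']
  · obtain ⟨h1, h2, h3⟩ := hin x hx
    rw [hNw x (hpos _ h3), inv_mul_le_iff₀ hNy, Real.rpow_neg h2.le, ← div_eq_mul_inv,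
      le_div_iff₀ (by positivity)]
    have hNz : 0 ≤ N (y + l • x) := by
      have := hpos _ h3
      positivity
    have h4 : N (y + l • x) * (D * (1 - ‖x‖ / (D / l))) ^ γ ≤ N y * D ^ γ :=
      le_trans (by gcongr) (hmax _ h3)
    rw [Real.mul_rpow hD0 h2.le] at h4
    have hDγ : 0 < D ^ γ := by positivity
    refine le_of_mul_le_mul_right ?_ hDγ
    linarith

theorem exists_weighted_gradient_bound (ha : 0 < a) (hq : 0 < q) (hpq : 1 < p + q)
    (haq : a * q ≤ p + q - 1)
    (hLiou : ∀ u : Euc n → ℝ, ContDiff ℝ 2 u → (∀ x, 0 < u x) →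
      (∀ x, elaplacian u x + ‖gradient u x‖ ^ q * u x ^ p = 0) → ∀ x y, u x = u y) :
    ∃ C > 0, ∀ Ω : Set (Euc n), IsOpen Ω → (frontier Ω).Nonempty →
      ∀ u : Euc n → ℝ, ContDiffOn ℝ 2 u Ω → (∀ x ∈ Ω, 0 < u x) →
        (∀ x ∈ Ω, elaplacian u x + ‖gradient u x‖ ^ q * u x ^ p = 0) → ∀ x ∈ Ω,
          u x ^ (a - 1) * ‖fderiv ℝ u x‖ ≤
            C * Metric.infDist x (frontier Ω) ^ (-1 - a * (2 - q) / (p + q - 1)) := by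
  have hs : 0 < p + q - 1 := by linarith
  set γ : ℝ := 1 + a * ((2 - q) / (p + q - 1)) with hγdef
  have hγ : 0 < γ := by
    have : γ = (p + q - 1 - a * q + 2 * a) / (p + q - 1) := by
      rw [hγdef]; field_simp; ring
    rw [this]
    exact div_pos (by linarith) hs
  obtain ⟨R₀, hR₀, hnot⟩ := IsNormalized.exists_radius_bound ha hq hγ.le haq hLiou
  refine ⟨R₀ ^ γ, by positivity, fun Ω hΩ hfr u hu hpos heq x hx => ?_⟩
  set d := Metric.infDist x (frontier Ω) with hd
  have hd0 : 0 < d := by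
    refine (isClosed_frontier.notMem_iff_infDist_pos hfr).1 fun h => ?_
    rw [hΩ.frontier_eq] at h
    exact h.2 hx
  have hsub : Metric.ball x d ⊆ Ω := ball_infDist_frontier_subset hx
  have key : ∀ r ∈ Ioo 0 d, u x ^ (a - 1) * ‖fderiv ℝ u x‖ * r ^ γ ≤ R₀ ^ γ := by
    intro r hr
    by_contra! hcon
    obtain ⟨v, hv, hvu⟩ := exists_contDiff_eventuallyEq hr.1 hr.2 (hu.mono hsub)
    have hrs : Metric.closedBall x r ⊆ Ω :=
      (Metric.closedBall_subset_ball hr.2).trans hsub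
    have hxr : x ∈ Metric.closedBall x r := Metric.mem_closedBall_self hr.1.le
    obtain ⟨R, hR, w, hw⟩ := exists_isNormalized (p := p) (q := q) (a := a) hv hpq hγ hγdef hr.1
      hR₀ (fun z hz => (hvu z hz).eq_of_nhds ▸ hpos z (hrs hz)) (fun z hz => by
        have h := heq z (hrs hz)
        rw [norm_gradient] at h
        rw [(hvu z hz).elaplacian_eq, (hvu z hz).fderiv_eq, (hvu z hz).eq_of_nhds]
        linarith) (by
        rw [(hvu x hxr).fderiv_eq, (hvu x hxr).eq_of_nhds]
        exact hcon.le)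
    exact hnot R hR w hw
  have hlim : u x ^ (a - 1) * ‖fderiv ℝ u x‖ * d ^ γ ≤ R₀ ^ γ := by
    have hc : Tendsto (fun r : ℝ => u x ^ (a - 1) * ‖fderiv ℝ u x‖ * r ^ γ) (𝓝[<] d)
        (𝓝 (u x ^ (a - 1) * ‖fderiv ℝ u x‖ * d ^ γ)) :=
      ((Real.continuousAt_rpow_const d γ (Or.inr hγ.le)).tendsto.const_mul _).mono_left
        nhdsWithin_le_nhds
    exact le_of_tendsto hc (by
      filter_upwards [Ioo_mem_nhdsLT hd0] with r hr using key r hr)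
  have hexp : -1 - a * (2 - q) / (p + q - 1) = -γ := by rw [hγdef]; ring
  rw [hexp, Real.rpow_neg hd0.le, ← div_eq_mul_inv, le_div_iff₀ (by positivity)]
  exact hlim

lemma norm_gradient_rpow {u : Euc n → ℝ} {x : Euc n} (hu : DifferentiableAt ℝ u x) (hx : 0 < u x)
    (ha : 0 < a) : ‖gradient (fun y => u y ^ a) x‖ = a * (u x ^ (a - 1) * ‖fderiv ℝ u x‖) := by
  rw [norm_gradient, (hu.hasFDerivAt.rpow_const (p := a) (Or.inl hx.ne')).fderiv, norm_smul,
    Real.norm_of_nonneg (by positivity), mul_assoc]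

end Blowup

end

/-- **Theorem 1.5.** Suppose `q > 0`, `p + q > 1` and the Liouville property holds for
`(p,q)` in dimension `n`. With `a = (p+q−1)/q`, every positive classical solution of
`Δu + |∇u|^q u^p = 0` on a domain `Ω ⊊ ℝⁿ` satisfies
`|∇(u^a)(x)| ≤ C · dist(x, ∂Ω)^(−1 − a(2−q)/(p+q−1))`; and if moreover `p > 1` the same
estimate holds with `a = 1`. -/
theorem gradient_power_estimate_of_liouville (n : ℕ) (hn : 2 ≤ n) (p q : ℝ)
    (hq : 0 < q) (hpq : 1 < p + q)
    (hLiou : ∀ u : EuclideanSpace ℝ (Fin n) → ℝ,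
      ContDiff ℝ 2 u → (∀ x, 0 < u x) →
      (∀ x, elaplacian u x + ‖gradient u x‖ ^ q * u x ^ p = 0) →
      ∀ x y, u x = u y) :
    (∃ C > (0 : ℝ), ∀ Ω : Set (EuclideanSpace ℝ (Fin n)),
      IsOpen Ω → IsConnected Ω → Ω ≠ Set.univ → (frontier Ω).Nonempty →
      ∀ u : EuclideanSpace ℝ (Fin n) → ℝ,
        ContDiffOn ℝ 2 u Ω → (∀ x ∈ Ω, 0 < u x) →
        (∀ x ∈ Ω, elaplacian u x + ‖gradient u x‖ ^ q * u x ^ p = 0) →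
        ∀ x ∈ Ω,
          ‖gradient (fun y => u y ^ ((p + q - 1) / q)) x‖
            ≤ C * Metric.infDist x (frontier Ω)
                ^ (-1 - ((p + q - 1) / q) * (2 - q) / (p + q - 1))) ∧
    (1 < p → ∃ C > (0 : ℝ), ∀ Ω : Set (EuclideanSpace ℝ (Fin n)),
      IsOpen Ω → IsConnected Ω → Ω ≠ Set.univ → (frontier Ω).Nonempty →
      ∀ u : EuclideanSpace ℝ (Fin n) → ℝ,
        ContDiffOn ℝ 2 u Ω → (∀ x ∈ Ω, 0 < u x) →
        (∀ x ∈ Ω, elaplacian u x + ‖gradient u x‖ ^ q * u x ^ p = 0) →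
        ∀ x ∈ Ω,
          ‖gradient u x‖
            ≤ C * Metric.infDist x (frontier Ω) ^ (-1 - (2 - q) / (p + q - 1))) := by
  have hs : 0 < p + q - 1 := by linarith
  have ha : 0 < (p + q - 1) / q := div_pos hs hq
  refine ⟨?_, fun hp => ?_⟩
  · obtain ⟨C, hC, h⟩ := exists_weighted_gradient_bound ha hq hpq
      (div_mul_cancel₀ _ hq.ne').le hLiou
    refine ⟨(p + q - 1) / q * C, by positivity, fun Ω hΩ _ _ hfr u hu hpos heq x hx => ?_⟩
    rw [norm_gradient_rpow ((hu.contDiffAt (hΩ.mem_nhds hx)).differentiableAt two_ne_zero)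
      (hpos x hx) ha, mul_assoc]
    exact mul_le_mul_of_nonneg_left (h Ω hΩ hfr u hu hpos heq x hx) ha.le
  · obtain ⟨C, hC, h⟩ := exists_weighted_gradient_bound one_pos hq hpq (by linarith) hLiou
    refine ⟨C, hC, fun Ω hΩ _ _ hfr u hu hpos heq x hx => ?_⟩
    simpa [norm_gradient] using h Ω hΩ hfr u hu hpos heq x hx
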